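/- Let u be a k-connected weak hook word of hook type V and weak length r with 1 ≤ r ≤ k, let λ ∈ 𝒫_k, and suppose u · λ = μ with μ ∈ 𝒫_k (dot action on k-bounded partitions, result nonzero). Then: λ ⊆ μ and λ^{(k)} ⊆ μ^{(k)}; |μ/λ| = r; 𝔭^{-1}(μ)/𝔭^{-1}(λ) is a ribbon whose support supp(𝔭^{-1}(μ)/𝔭^{-1}(λ)) is k-connected; ht(μ/λ) + ht(μ^{(k)}/λ^{(k)}) = r − 1; and ht(μ/λ) = asc(u). -/

import Mathlib

open scoped BigOperators Classical

noncomputable section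

namespace MN

/-! ## Residues, words, canonical cyclic intervals -/

/-- The residues `ℤ/(k+1)ℤ`. -/
abbrev Idx (k : ℕ) := ZMod (k + 1)

/-- A word in the generators, recorded by its list of indices. -/
abbrev Word (k : ℕ) := List (Idx k)

/-- The support of a word. -/
def supp (k : ℕ) (u : Word k) : Finset (Idx k) := u.toFinset

/-- The smallest `a ∈ {0,…,k}` (as a natural number) with `(a : ℤ/(k+1)) ∉ S`. -/
def gapNat (k : ℕ) (S : Finset (Idx k)) : ℕ :=
  if h : ∃ m : ℕ, m ≤ k ∧ (m : Idx k) ∉ S then Nat.find h else 0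

/-- The gap element `a` of a proper subset `S`. -/
def gap (k : ℕ) (S : Finset (Idx k)) : Idx k := (gapNat k S : Idx k)

/-- Position of a residue `i` in the canonical cyclic interval
`I_S : a+1 < a+2 < ⋯ < k < 0 < ⋯ < a−1` (the gap `a` itself gets the junk position `k`). -/
def pos (k : ℕ) (S : Finset (Idx k)) (i : Idx k) : ℕ := (i - gap k S - 1).val

/-- The list of positions of the letters of `u` in the canonical cyclic interval of its support. -/
def posList (k : ℕ) (u : Word k) : List ℕ := u.map (pos k (supp k u))

/-- A weak hook word of hook type V:
`i₁ > ⋯ > i_j < i_{j+1} < ⋯ < i_m` with respect to `I_{supp u}`. -/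
def IsHookV (k : ℕ) (u : Word k) : Prop :=
  supp k u ≠ Finset.univ ∧
    ∃ (ds as : List ℕ) (v : ℕ),
      posList k u = ds ++ v :: as ∧
        List.Chain' (· > ·) (ds ++ [v]) ∧ List.Chain' (· < ·) (v :: as)

/-- A weak hook word of hook type U:
`i₁ > ⋯ > i_j = i_{j+1} < ⋯ < i_m` with respect to `I_{supp u}`. -/
def IsHookU (k : ℕ) (u : Word k) : Prop :=
  supp k u ≠ Finset.univ ∧
    ∃ (ds as : List ℕ) (v : ℕ),
      posList k u = ds ++ v :: v :: as ∧
        List.Chain' (· > ·) (ds ++ [v]) ∧ List.Chain' (· < ·) (v :: as)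

/-- A weak hook word. -/
def IsWeakHook (k : ℕ) (u : Word k) : Prop := IsHookV k u ∨ IsHookU k u

/-- The number of ascents `i_t < i_{t+1}` of a word. -/
def asc (k : ℕ) (u : Word k) : ℕ :=
  ((posList k u).zip (posList k u).tail).countP fun p => decide (p.1 < p.2)

/-- The candidates `c` in the definition of `u_min`: letters `c` of `u` for which there is a
letter `a` of `u` with `a < c` in `I_{supp u}`, `a + 1 ≠ c`, and no letter `b` of `u` satisfies
`a < b < c`. -/
def uminCands (k : ℕ) (u : Word k) : Finset (Idx k) :=
  (supp k u).filter fun c =>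
    ∃ a ∈ supp k u,
      pos k (supp k u) a < pos k (supp k u) c ∧ a + 1 ≠ c ∧
        ∀ b ∈ supp k u,
          ¬(pos k (supp k u) a < pos k (supp k u) b ∧
            pos k (supp k u) b < pos k (supp k u) c)

/-- The letter `u_min` of `u` (junk value `0` if there is no candidate). -/
def umin (k : ℕ) (u : Word k) : Idx k :=
  if h : (uminCands k u).Nonempty then
    ((uminCands k u).exists_min_image (pos k (supp k u)) h).choose
  else 0

/-- The number of occurrences of `u_min` in `u` (`0` if there is no candidate). -/
def uminCount (k : ℕ) (u : Word k) : ℕ :=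
  if (uminCands k u).Nonempty then u.count (umin k u) else 0

/-- A set of residues is `k`-connected if it is a proper subset of `{0,…,k}` which is an
interval with respect to its canonical cyclic interval order. -/
def IsKConnectedSet (k : ℕ) (S : Finset (Idx k)) : Prop :=
  S ≠ Finset.univ ∧
    ∀ i ∈ S, ∀ j ∈ S, ∀ m : Idx k,
      pos k S i ≤ pos k S m → pos k S m ≤ pos k S j → m ∈ S

/-- A word is `k`-connected if its support is. -/
def IsKConnected (k : ℕ) (u : Word k) : Prop := IsKConnectedSet k (supp k u)

/-- A word is `k`-weak connected if `u_min` occurs `0` or `2` times in it. -/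
def IsWeakConnected (k : ℕ) (u : Word k) : Prop :=
  uminCount k u = 0 ∨ uminCount k u = 2

/-- The letter `c` lies on the left side (the maximal strictly decreasing initial segment) of
the hook form of `u`: equivalently, it occurs in some strictly decreasing initial segment. -/
def OnLeftSide (k : ℕ) (u : Word k) (c : Idx k) : Prop :=
  ∃ p q : Word k, u = p ++ q ∧
    List.Chain' (fun a b => pos k (supp k u) b < pos k (supp k u) a) p ∧ c ∈ p

/-- The letter `c` lies on the right side (the maximal strictly increasing final segment) of
the hook form of `u`. -/
def OnRightSide (k : ℕ) (u : Word k) (c : Idx k) : Prop :=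
  ∃ p q : Word k, u = p ++ q ∧
    List.Chain' (fun a b => pos k (supp k u) a < pos k (supp k u) b) q ∧ c ∈ q

/-! ## The sets `X^r_i` and their refinements (indexed by `i : ℤ`, empty for `i < 0`) -/

/-- `V^r_i`: weak hook words of hook type V, weak length `r`, `asc = i`. -/
def VSet (k r : ℕ) (i : ℤ) : Set (Word k) :=
  {u | IsHookV k u ∧ u.length = r ∧ (asc k u : ℤ) = i}

/-- `U^r_i`. -/
def USet (k r : ℕ) (i : ℤ) : Set (Word k) :=
  {u | IsHookU k u ∧ u.length = r ∧ (asc k u : ℤ) = i}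

/-- `V^r_{i,wc}`: the `k`-weak connected members of `V^r_i`. -/
def VSetWC (k r : ℕ) (i : ℤ) : Set (Word k) := {u ∈ VSet k r i | IsWeakConnected k u}

/-- `U^r_{i,wc}`. -/
def USetWC (k r : ℕ) (i : ℤ) : Set (Word k) := {u ∈ USet k r i | IsWeakConnected k u}

/-- `V^r_{i,c}`: the `k`-connected members of `V^r_i`. -/
def VSetC (k r : ℕ) (i : ℤ) : Set (Word k) := {u ∈ VSet k r i | IsKConnected k u}

/-- `V^r_{i,w̄c,left}`. -/
def VSetNWCL (k r : ℕ) (i : ℤ) : Set (Word k) :=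
  {u ∈ VSet k r i | ¬IsWeakConnected k u ∧ OnLeftSide k u (umin k u)}

/-- `V^r_{i,w̄c,right}`. -/
def VSetNWCR (k r : ℕ) (i : ℤ) : Set (Word k) :=
  {u ∈ VSet k r i | ¬IsWeakConnected k u ∧ OnRightSide k u (umin k u)}

/-- `U^r_{i,w̄c,left}`. -/
def USetNWCL (k r : ℕ) (i : ℤ) : Set (Word k) :=
  {u ∈ USet k r i | ¬IsWeakConnected k u ∧ OnLeftSide k u (umin k u)}

/-- `U^r_{i,w̄c,right}`. -/
def USetNWCR (k r : ℕ) (i : ℤ) : Set (Word k) :=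
  {u ∈ USet k r i | ¬IsWeakConnected k u ∧ OnRightSide k u (umin k u)}

/-! ## The algebras `𝒜_k`, `ℋ_k`, `𝒩_k` -/

/-- The defining relations of `𝒜_k`. -/
inductive AkRel (k : ℕ) : FreeAlgebra ℤ (Idx k) → FreeAlgebra ℤ (Idx k) → Prop
  | braid (i : Idx k) :
      AkRel k (FreeAlgebra.ι ℤ i * FreeAlgebra.ι ℤ (i + 1) * FreeAlgebra.ι ℤ i)
        (FreeAlgebra.ι ℤ (i + 1) * FreeAlgebra.ι ℤ i * FreeAlgebra.ι ℤ (i + 1))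
  | comm (i j : Idx k) (h1 : i - j ≠ 1) (h2 : j - i ≠ 1) :
      AkRel k (FreeAlgebra.ι ℤ i * FreeAlgebra.ι ℤ j)
        (FreeAlgebra.ι ℤ j * FreeAlgebra.ι ℤ i)

/-- The algebra `𝒜_k`. -/
abbrev Ak (k : ℕ) := RingQuot (AkRel k)

/-- The generator `A_i` of `𝒜_k`. -/
def Agen (k : ℕ) (i : Idx k) : Ak k := RingQuot.mkAlgHom ℤ (AkRel k) (FreeAlgebra.ι ℤ i)

/-- The element `A_{i₁} ⋯ A_{i_m}` of `𝒜_k` associated to a word. -/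
def Aword (k : ℕ) (u : Word k) : Ak k := (u.map (Agen k)).prod

/-- The defining relations of the 0-Hecke algebra `ℋ_k`. -/
inductive HkRel (k : ℕ) : FreeAlgebra ℤ (Idx k) → FreeAlgebra ℤ (Idx k) → Prop
  | braid (i : Idx k) :
      HkRel k (FreeAlgebra.ι ℤ i * FreeAlgebra.ι ℤ (i + 1) * FreeAlgebra.ι ℤ i)
        (FreeAlgebra.ι ℤ (i + 1) * FreeAlgebra.ι ℤ i * FreeAlgebra.ι ℤ (i + 1))
  | comm (i j : Idx k) (h1 : i - j ≠ 1) (h2 : j - i ≠ 1) :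
      HkRel k (FreeAlgebra.ι ℤ i * FreeAlgebra.ι ℤ j)
        (FreeAlgebra.ι ℤ j * FreeAlgebra.ι ℤ i)
  | sq (i : Idx k) :
      HkRel k (FreeAlgebra.ι ℤ i * FreeAlgebra.ι ℤ i) (-(FreeAlgebra.ι ℤ i))

/-- The 0-Hecke algebra `ℋ_k`. -/
abbrev Hk (k : ℕ) := RingQuot (HkRel k)

/-- The generator `H_i`. -/
def Hgen (k : ℕ) (i : Idx k) : Hk k := RingQuot.mkAlgHom ℤ (HkRel k) (FreeAlgebra.ι ℤ i)

/-- The element `H_{i₁} ⋯ H_{i_m}`. -/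
def Hword (k : ℕ) (u : Word k) : Hk k := (u.map (Hgen k)).prod

/-- The defining relations of the nilCoxeter algebra `𝒩_k`. -/
inductive NkRel (k : ℕ) : FreeAlgebra ℤ (Idx k) → FreeAlgebra ℤ (Idx k) → Prop
  | braid (i : Idx k) :
      NkRel k (FreeAlgebra.ι ℤ i * FreeAlgebra.ι ℤ (i + 1) * FreeAlgebra.ι ℤ i)
        (FreeAlgebra.ι ℤ (i + 1) * FreeAlgebra.ι ℤ i * FreeAlgebra.ι ℤ (i + 1))
  | comm (i j : Idx k) (h1 : i - j ≠ 1) (h2 : j - i ≠ 1) :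
      NkRel k (FreeAlgebra.ι ℤ i * FreeAlgebra.ι ℤ j)
        (FreeAlgebra.ι ℤ j * FreeAlgebra.ι ℤ i)
  | sq (i : Idx k) :
      NkRel k (FreeAlgebra.ι ℤ i * FreeAlgebra.ι ℤ i) 0

/-- The nilCoxeter algebra `𝒩_k`. -/
abbrev Nk (k : ℕ) := RingQuot (NkRel k)

/-- The generator `N_i`. -/
def Ngen (k : ℕ) (i : Idx k) : Nk k := RingQuot.mkAlgHom ℤ (NkRel k) (FreeAlgebra.ι ℤ i)

/-- The element `N_{i₁} ⋯ N_{i_m}`. -/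
def Nword (k : ℕ) (u : Word k) : Nk k := (u.map (Ngen k)).prod

/-! ## The affine symmetric group -/

/-- The relators of the affine symmetric group `S̃_{k+1}`. -/
def CoxRels (k : ℕ) : Set (FreeGroup (Idx k)) :=
  {g | (∃ i : Idx k, g = FreeGroup.of i * FreeGroup.of i) ∨
    (∃ i : Idx k,
      g = FreeGroup.of i * FreeGroup.of (i + 1) * FreeGroup.of i *
        (FreeGroup.of (i + 1) * FreeGroup.of i * FreeGroup.of (i + 1))⁻¹) ∨
    (∃ i j : Idx k, i - j ≠ 1 ∧ j - i ≠ 1 ∧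
      g = FreeGroup.of i * FreeGroup.of j * (FreeGroup.of j * FreeGroup.of i)⁻¹)}

/-- The affine symmetric group `S̃_{k+1}`. -/
abbrev AffS (k : ℕ) := PresentedGroup (CoxRels k)

/-- The generator `s_i`. -/
def sgen (k : ℕ) (i : Idx k) : AffS k := PresentedGroup.of i

/-- The product `s_{i₁} ⋯ s_{i_m}`. -/
def sword (k : ℕ) (u : Word k) : AffS k := (u.map (sgen k)).prod

/-- The Coxeter length of `w ∈ S̃_{k+1}`. -/
def len (k : ℕ) (w : AffS k) : ℕ :=
  sInf {m | ∃ u : Word k, u.length = m ∧ sword k u = w}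

/-- `u` is a reduced word. -/
def IsReducedWord (k : ℕ) (u : Word k) : Prop := len k (sword k u) = u.length

/-- The finite symmetric group `S_{k+1} = ⟨s_1, …, s_k⟩` inside `S̃_{k+1}`. -/
def FinSub (k : ℕ) : Subgroup (AffS k) :=
  Subgroup.closure {g | ∃ i : Idx k, i ≠ 0 ∧ g = sgen k i}

/-- `w` is a minimal-length coset representative of `S̃_{k+1}/S_{k+1}` (a Grassmannian
element). -/
def IsGrassmannian (k : ℕ) (w : AffS k) : Prop :=
  ∀ v : AffS k, w⁻¹ * v ∈ FinSub k → len k w ≤ len k v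

/-! ## Anti-weak hook words -/

/-- Anti-weak hook word, first form: `i₁ < ⋯ < i_j > i_{j+1} > ⋯ > i_m`. -/
def IsAntiHookV (k : ℕ) (u : Word k) : Prop :=
  supp k u ≠ Finset.univ ∧
    ∃ (ds as : List ℕ) (v : ℕ),
      posList k u = ds ++ v :: as ∧
        List.Chain' (· < ·) (ds ++ [v]) ∧ List.Chain' (· > ·) (v :: as)

/-- Anti-weak hook word, second form: `i₁ < ⋯ < i_j = i_{j+1} > ⋯ > i_m`. -/
def IsAntiHookU (k : ℕ) (u : Word k) : Prop :=
  supp k u ≠ Finset.univ ∧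
    ∃ (ds as : List ℕ) (v : ℕ),
      posList k u = ds ++ v :: v :: as ∧
        List.Chain' (· < ·) (ds ++ [v]) ∧ List.Chain' (· > ·) (v :: as)

/-- Anti-weak hook word. -/
def IsAntiWeakHook (k : ℕ) (u : Word k) : Prop := IsAntiHookV k u ∨ IsAntiHookU k u

/-- Length of the maximal strictly increasing (w.r.t. `I_{supp u}`) initial segment of `u`
(= the left side of an anti-weak hook word). -/
def incPrefixLen (k : ℕ) (u : Word k) : ℕ :=
  sSup {n | n ≤ u.length ∧
    List.Chain' (fun a b => pos k (supp k u) a < pos k (supp k u) b) (u.take n)}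

/-- Length of the maximal strictly increasing (w.r.t. `I_{supp u}`) final segment of `u`
(= the right side of a weak hook word). -/
def incSuffixLen (k : ℕ) (u : Word k) : ℕ :=
  sSup {n | n ≤ u.length ∧
    List.Chain' (fun a b => pos k (supp k u) a < pos k (supp k u) b)
      (u.drop (u.length - n))}

/-! ## Noncommutative symmetric functions in `𝒜_k` -/

/-- The word underlying the cyclically decreasing element `d_A` (letters of `A` in decreasing
position order, so that `A_{i+1}` occurs before `A_i` whenever `i, i+1 ∈ A`). -/
def dwordOf (k : ℕ) (A : Finset (Idx k)) : Word k :=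
  (((A.image (pos k A)).sort (· ≤ ·)).reverse).map fun n => gap k A + 1 + (n : Idx k)

/-- The word underlying the cyclically increasing element `i_A`. -/
def iwordOf (k : ℕ) (A : Finset (Idx k)) : Word k :=
  ((A.image (pos k A)).sort (· ≤ ·)).map fun n => gap k A + 1 + (n : Idx k)

/-- The noncommutative homogeneous symmetric function `h_r = Σ_{|A| = r} d_A`. -/
def hFun (k r : ℕ) : Ak k :=
  ∑ A ∈ Finset.powersetCard r (Finset.univ : Finset (Idx k)), Aword k (dwordOf k A)

/-- The noncommutative elementary symmetric function `e_r = Σ_{|A| = r} i_A`. -/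
def eFun (k r : ℕ) : Ak k :=
  ∑ A ∈ Finset.powersetCard r (Finset.univ : Finset (Idx k)), Aword k (iwordOf k A)

/-- The noncommutative hook Schur function `s_{(r−i,1^i)}`. -/
def sHookFun (k r i : ℕ) : Ak k :=
  ∑ j ∈ Finset.range (i + 1), ((-1 : ℤ) ^ j) • (hFun k (r - i + j) * eFun k (i - j))

/-- The noncommutative power sum `p_r`. -/
def pFun (k r : ℕ) : Ak k :=
  ∑ i ∈ Finset.range r, ((-1 : ℤ) ^ i) • sHookFun k r i

/-! ## Actions on the affine symmetric group -/

/-- The star action of a generator: `A_i * w = s_i w` if `l(s_i w) > l(w)`, else `w`. -/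
def starG (k : ℕ) (i : Idx k) (w : AffS k) : AffS k :=
  if len k w < len k (sgen k i * w) then sgen k i * w else w

/-- The star action of a word: `A_{i₁}⋯A_{i_m} * w = A_{i₁} * (⋯ * (A_{i_m} * w))`. -/
def starW (k : ℕ) (u : Word k) (w : AffS k) : AffS k := u.foldr (starG k) w

/-- The dot action of a generator, with values in `S̃_{k+1} ∪ {0}`. -/
def dotG (k : ℕ) (i : Idx k) : Option (AffS k) → Option (AffS k)
  | none => none
  | some w => if len k w < len k (sgen k i * w) then some (sgen k i * w) else none

/-- The dot action of a word. -/
def dotW (k : ℕ) (u : Word k) (o : Option (AffS k)) : Option (AffS k) :=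
  u.foldr (dotG k) o

/-- Extension of an action datum `act : generator → S̃ → S̃ ∪ {0}` to `S̃ ∪ {0}`. -/
def actExt (k : ℕ) (act : Idx k → AffS k → Option (AffS k)) (i : Idx k) :
    Option (AffS k) → Option (AffS k)
  | none => none
  | some w => act i w

/-- Extension of an action datum to words. -/
def actW (k : ℕ) (act : Idx k → AffS k → Option (AffS k)) (u : Word k)
    (o : Option (AffS k)) : Option (AffS k) :=
  u.foldr (actExt k act) o

/-! ## Rings and coefficients -/

/-- `(−1)^n` for an integer exponent `n`, in any ring. -/
def msign (R : Type*) [Ring R] (n : ℤ) : R := (((-1 : Rˣ) ^ n : Rˣ) : R)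

/-- The power sum `p^R_r = Σ_{i=0}^{r−1} Σ_{j=0}^{i} (−1)^{i+j} h^R_{r−i+j} e^R_{i−j}` built from
Pieri data in a commutative ring. -/
def pR {R : Type*} [CommRing R] (h e : ℕ → R) (r : ℕ) : R :=
  ∑ i ∈ Finset.range r, ∑ j ∈ Finset.range (i + 1),
    ((-1 : ℤ) ^ (i + j)) • (h (r - i + j) * e (i - j))

/-- The integer coefficient
`Σ_{i=0}^{r−1} (−1)^i |V^r_{i,wc} ∩ P| + Σ_{i=1}^{r−1} (−1)^i (r−i) |U^r_{i−1,wc} ∩ P|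
 + Σ_{i=1}^{r−2} (−1)^i |U^r_{i−1,w̄c,left} ∩ P|`. -/
def MNcoeff (k r : ℕ) (P : Word k → Prop) : ℤ :=
  (∑ i ∈ Finset.range r, (-1 : ℤ) ^ i * ({u ∈ VSetWC k r (i : ℤ) | P u}.ncard : ℤ)) +
    (∑ i ∈ Finset.Icc 1 (r - 1),
      (-1 : ℤ) ^ i * ((r : ℤ) - i) * ({u ∈ USetWC k r ((i : ℤ) - 1) | P u}.ncard : ℤ)) +
    ∑ i ∈ Finset.Icc 1 (r - 2),
      (-1 : ℤ) ^ i * ({u ∈ USetNWCL k r ((i : ℤ) - 1) | P u}.ncard : ℤ)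

/-- The integer coefficient `Σ_{i=0}^{r−1} (−1)^i |V^r_{i,c} ∩ P|`. -/
def kcoeff (k r : ℕ) (P : Word k → Prop) : ℤ :=
  ∑ i ∈ Finset.range r, (-1 : ℤ) ^ i * ({u ∈ VSetC k r (i : ℤ) | P u}.ncard : ℤ)

/-! ## Partitions, cores, bounded partitions -/

/-- A cell of a Young diagram: (row, column), `0`-indexed. -/
abbrev Cell := ℕ × ℕ

/-- A (finite) Young diagram, as a finite lower set of cells. -/
def IsYoung (S : Set Cell) : Prop :=
  S.Finite ∧ ∀ p ∈ S, ∀ q : Cell, q.1 ≤ p.1 → q.2 ≤ p.2 → q ∈ S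

/-- The `(k+1)`-residue of a cell `(i,j)`, i.e. `j − i mod (k+1)`. -/
def res (k : ℕ) (c : Cell) : Idx k := (c.2 : Idx k) - (c.1 : Idx k)

/-- The hook length of a cell: arm + leg + 1. -/
def hookLen (S : Set Cell) (c : Cell) : ℕ :=
  {j | c.2 < j ∧ (c.1, j) ∈ S}.ncard + {i | c.1 < i ∧ (i, c.2) ∈ S}.ncard + 1

/-- A `(k+1)`-core: a partition with no cell of hook length `k+1`. -/
def IsCore (k : ℕ) (S : Set Cell) : Prop :=
  IsYoung S ∧ ∀ c ∈ S, hookLen S c ≠ k + 1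

/-- A `k`-bounded partition: every part is at most `k`. -/
def IsBounded (k : ℕ) (S : Set Cell) : Prop :=
  IsYoung S ∧ ∀ c ∈ S, c.2 < k

/-- A removable corner of `S`. -/
def Removable (S : Set Cell) (c : Cell) : Prop :=
  c ∈ S ∧ (c.1 + 1, c.2) ∉ S ∧ (c.1, c.2 + 1) ∉ S

/-- An addable corner of `S`: a cell not in `S` whose addition yields a partition. -/
def Addable (S : Set Cell) (c : Cell) : Prop :=
  c ∉ S ∧ IsYoung (S ∪ {c})

/-- The map `𝔭` from `(k+1)`-cores to `k`-bounded partitions: row `i` of `𝔭(κ)` has as many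
cells as there are cells of hook length at most `k` in row `i` of `κ`. -/
def pMap (k : ℕ) (S : Set Cell) : Set Cell :=
  {c | c.2 < {j | (c.1, j) ∈ S ∧ hookLen S (c.1, j) ≤ k}.ncard}

/-- The inverse bijection `𝔭^{-1}` from `k`-bounded partitions to `(k+1)`-cores. -/
def pInv (k : ℕ) (lam : Set Cell) : Set Cell :=
  Function.invFunOn (pMap k) {S | IsCore k S} lam

/-- The transpose (conjugate) of a diagram. -/
def transposeSet (S : Set Cell) : Set Cell := {c | (c.2, c.1) ∈ S}

/-- The `k`-conjugate `λ^{(k)} = 𝔭((𝔭^{-1} λ)^t)`. -/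
def kconj (k : ℕ) (lam : Set Cell) : Set Cell := pMap k (transposeSet (pInv k lam))

/-- A skew shape is a ribbon if it contains no `2×2` square. -/
def IsRibbon (D : Set Cell) : Prop :=
  ∀ c : Cell, ¬((c.1, c.2) ∈ D ∧ (c.1 + 1, c.2) ∈ D ∧
    (c.1, c.2 + 1) ∈ D ∧ (c.1 + 1, c.2 + 1) ∈ D)

/-- A vertical strip: no two cells in the same row. -/
def IsVStrip (D : Set Cell) : Prop :=
  ∀ c ∈ D, ∀ c' ∈ D, c.1 = c'.1 → c = c'

/-- A horizontal strip: no two cells in the same column. -/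
def IsHStrip (D : Set Cell) : Prop :=
  ∀ c ∈ D, ∀ c' ∈ D, c.2 = c'.2 → c = c'

/-- The height of a skew shape: the number of occupied rows minus the number of connected
components; each connected component is counted by its unique last occupied row, i.e. an
occupied row sharing no column with the next row. -/
def htSkew (D : Set Cell) : ℕ :=
  {i : ℕ | ∃ j, (i, j) ∈ D}.ncard -
    {i : ℕ | (∃ j, (i, j) ∈ D) ∧ ¬∃ j, (i, j) ∈ D ∧ (i + 1, j) ∈ D}.ncard

/-- The set of `(k+1)`-residues of the cells of a skew shape. -/
def residSupp (k : ℕ) (D : Set Cell) : Finset (Idx k) :=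
  Set.Finite.toFinset (Set.toFinite (res k '' D))

/-! ## Star and dot actions on cores and on `k`-bounded partitions -/

/-- The star action of `A_i` on `(k+1)`-cores together with `0`. -/
def starC (k : ℕ) (i : Idx k) : Option (Set Cell) → Option (Set Cell)
  | none => none
  | some S =>
    if ∃ c, Addable S c ∧ res k c = i then some (S ∪ {c | Addable S c ∧ res k c = i})
    else if ∃ c, Removable S c ∧ res k c = i then some S
    else none

/-- The star action of a word on cores. -/
def starCW (k : ℕ) (u : Word k) (o : Option (Set Cell)) : Option (Set Cell) :=
  u.foldr (starC k) o

/-- The star action of a word on `k`-bounded partitions, transported through `𝔭`. -/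
def starB (k : ℕ) (u : Word k) (lam : Set Cell) : Option (Set Cell) :=
  (starCW k u (some (pInv k lam))).map (pMap k)

/-- The dot action of `A_i` on `(k+1)`-cores together with `0`. -/
def dotC (k : ℕ) (i : Idx k) : Option (Set Cell) → Option (Set Cell)
  | none => none
  | some S =>
    if ∃ c, Addable S c ∧ res k c = i then some (S ∪ {c | Addable S c ∧ res k c = i})
    else none

/-- The dot action of a word on cores. -/
def dotCW (k : ℕ) (u : Word k) (o : Option (Set Cell)) : Option (Set Cell) :=
  u.foldr (dotC k) o

/-- The dot action of a word on `k`-bounded partitions, transported through `𝔭`. -/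
def dotB (k : ℕ) (u : Word k) (lam : Set Cell) : Option (Set Cell) :=
  (dotCW k u (some (pInv k lam))).map (pMap k)

/-- The number of maximal segments of consecutive letters (w.r.t. the positions for `S`) of a
word `V`. -/
def numSegments (k : ℕ) (S : Finset (Idx k)) (V : Word k) : ℕ :=
  if V.length = 0 then 0
  else ((V.zip V.tail).countP fun p => decide (pos k S p.2 ≠ pos k S p.1 + 1)) + 1

/-- Conditions (K0)–(K4) of the Murnaghan–Nakayama rule for `K`-`k`-Schur functions. -/
def Kconds (k r : ℕ) (lam mu : Set Cell) : Prop :=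
  lam ⊆ mu ∧ kconj k lam ⊆ kconj k mu ∧
    (mu \ lam).ncard ≤ r ∧
    IsRibbon (pInv k mu \ pInv k lam) ∧
    (IsKConnectedSet k (residSupp k (pInv k mu \ pInv k lam)) ∨
      (residSupp k (pInv k mu \ pInv k lam)).card < r) ∧
    htSkew (mu \ lam) + htSkew (kconj k mu \ kconj k lam) < r

/-- Conditions (k0)–(k4) of the Murnaghan–Nakayama rule for `k`-Schur functions. -/
def kconds (k r : ℕ) (lam mu : Set Cell) : Prop :=
  lam ⊆ mu ∧ kconj k lam ⊆ kconj k mu ∧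
    (mu \ lam).ncard = r ∧
    IsRibbon (pInv k mu \ pInv k lam) ∧
    IsKConnectedSet k (residSupp k (pInv k mu \ pInv k lam)) ∧
    htSkew (mu \ lam) + htSkew (kconj k mu \ kconj k lam) = r - 1



/-! ### Part 1: the abstract threshold model -/

lemma xm1_ne {k : ℕ} (hk : 1 ≤ k) (x : Idx k) : x - 1 ≠ x := by
  haveI : Fact (1 < k + 1) := ⟨by omega⟩
  intro h
  have : (1 : Idx k) = 0 := by linear_combination -h
  exact one_ne_zero this

lemma cast_eq_iff_dvd {k : ℕ} (a b : ℤ) : ((a : ℤ) : Idx k) = (b : Idx k) ↔ ((k : ℤ) + 1) ∣ b - a := by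
  have := ZMod.intCast_eq_intCast_iff_dvd_sub a b (k + 1)
  push_cast at this
  exact this

/-- the simple reflection on integers -/
def sact (k : ℕ) (x : Idx k) (p : ℤ) : ℤ :=
  if (p : Idx k) = x - 1 then p + 1 else if (p : Idx k) = x then p - 1 else p

lemma sact_sub {k : ℕ} {x : Idx k} {p : ℤ} (h : (p : Idx k) = x - 1) : sact k x p = p + 1 := by
  simp [sact, h]

lemma sact_eq {k : ℕ} (hk : 1 ≤ k) {x : Idx k} {p : ℤ} (h : (p : Idx k) = x) :
    sact k x p = p - 1 := by
  have := xm1_ne hk x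
  simp only [sact, h]
  rw [if_neg (fun h => this h.symm)]; simp

lemma sact_fix {k : ℕ} {x : Idx k} {p : ℤ} (h : (p : Idx k) ≠ x - 1) (h' : (p : Idx k) ≠ x) :
    sact k x p = p := by
  simp [sact, h, h']

lemma sact_cast_sub {k : ℕ} {x : Idx k} {p : ℤ} (h : (p : Idx k) = x - 1) :
    (sact k x p : Idx k) = x := by
  rw [sact_sub h]; push_cast; rw [h]; ring

lemma sact_cast_eq {k : ℕ} (hk : 1 ≤ k) {x : Idx k} {p : ℤ} (h : (p : Idx k) = x) :
    (sact k x p : Idx k) = x - 1 := by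
  rw [sact_eq hk h]; push_cast; rw [h]

lemma sact_sact {k : ℕ} (hk : 1 ≤ k) (x : Idx k) (p : ℤ) : sact k x (sact k x p) = p := by
  by_cases h : (p : Idx k) = x - 1
  · rw [sact_eq hk (sact_cast_sub h), sact_sub h]; ring
  · by_cases h' : (p : Idx k) = x
    · rw [sact_sub (sact_cast_eq hk h'), sact_eq hk h']; ring
    · rw [sact_fix h h', sact_fix h h']

lemma sact_shift {k : ℕ} (x : Idx k) (p c : ℤ) :
    sact k x (p + ((k : ℤ) + 1) * c) = sact k x p + ((k : ℤ) + 1) * c := by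
  have e : ((p + ((k : ℤ) + 1) * c : ℤ) : Idx k) = (p : Idx k) := by
    rw [cast_eq_iff_dvd]; exact ⟨-c, by ring⟩
  unfold sact
  rw [e]
  split_ifs <;> ring

/-- the cast of `sact` in terms of the cast -/
lemma sact_cast_congr {k : ℕ} (x : Idx k) (p q : ℤ) (h : (p : Idx k) = q) :
    (sact k x p : Idx k) = sact k x q := by
  unfold sact
  rw [h]
  split_ifs <;> push_cast <;> rw [h]

lemma sact_cast_inj {k : ℕ} (hk : 1 ≤ k) (x : Idx k) (p q : ℤ)
    (h : (sact k x p : Idx k) = sact k x q) : (p : Idx k) = q := by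
  have := sact_cast_congr x _ _ h
  rwa [sact_sact hk, sact_sact hk] at this

structure Good (k : ℕ) (w : Fin (k + 1) → ℤ) : Prop where
  mono : StrictMono w
  inj : Function.Injective (fun j => (w j : Idx k))

lemma Good.surj {k : ℕ} {w : Fin (k + 1) → ℤ} (h : Good k w) (x : Idx k) :
    ∃ j, (w j : Idx k) = x := by
  have hb : Function.Bijective (fun j => (w j : Idx k)) :=
    (Fintype.bijective_iff_injective_and_card _).2 ⟨h.inj, by simp [ZMod.card]⟩
  exact hb.2 x

def Valid (k : ℕ) (x : Idx k) (w : Fin (k + 1) → ℤ) : Prop :=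
  ∃ j m, j < m ∧ (w j : Idx k) = x ∧ (w m : Idx k) = x - 1

lemma Good.step {k : ℕ} (hk : 1 ≤ k) {w : Fin (k + 1) → ℤ} (h : Good k w) {x : Idx k}
    (hv : Valid k x w) : Good k (fun j => sact k x (w j)) := by
  obtain ⟨j, m, hjm, hj, hm⟩ := hv
  refine ⟨?_, ?_⟩
  · intro a b hab
    have hlt := h.mono hab
    have key : ∀ a b, (w a : Idx k) = w b → a = b := fun a b e => h.inj e
    have hxx := xm1_ne hk x
    show sact k x (w a) < sact k x (w b)
    by_cases ha : (w a : Idx k) = x - 1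
    · have ham : a = m := key _ _ (by rw [ha, hm])
      have hb1 : (w b : Idx k) ≠ x - 1 := fun e => hab.ne (key _ _ (by rw [ha, e]))
      have hb2 : (w b : Idx k) ≠ x := by
        intro e
        have : b = j := key _ _ (by rw [e, hj])
        subst this; subst ham
        exact absurd hab (not_lt.2 hjm.le)
      rw [sact_sub ha, sact_fix hb1 hb2]
      rcases (show w a + 1 ≤ w b from hlt).lt_or_eq with h1 | h1
      · exact h1
      · exfalso; apply hb2; rw [← h1]; push_cast; rw [ha]; ring
    · by_cases ha' : (w a : Idx k) = x
      · have hb2 : (w b : Idx k) ≠ x := fun e => hab.ne (key _ _ (by rw [ha', e]))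
        rw [sact_eq hk ha']
        by_cases hb : (w b : Idx k) = x - 1
        · rw [sact_sub hb]; omega
        · rw [sact_fix hb hb2]; omega
      · rw [sact_fix ha ha']
        by_cases hb : (w b : Idx k) = x - 1
        · rw [sact_sub hb]; omega
        · by_cases hb' : (w b : Idx k) = x
          · rw [sact_eq hk hb']
            rcases (show w a ≤ w b - 1 by omega).lt_or_eq with h1 | h1
            · exact h1
            · exfalso; apply ha; rw [h1]; push_cast; rw [hb']
          · rw [sact_fix hb hb']; exact hlt
  · intro a b e
    exact h.inj (sact_cast_inj hk x _ _ e)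

/-- column lengths -/
def Lw (k : ℕ) (w : Fin (k + 1) → ℤ) (j : Fin (k + 1)) : ℕ :=
  ∑ m, ((w m - w j) / ((k : ℤ) + 1)).toNat

lemma div_succ_of_not_dvd {n d : ℤ} (hn : 0 < n) (h : ¬ n ∣ d + 1) : (d + 1) / n = d / n := by
  have h1 := Int.emod_add_mul_ediv d n
  have h2 := Int.emod_nonneg d hn.ne'
  have h3 := Int.emod_lt_of_pos d hn
  have h4 : d % n + 1 ≠ n := by
    intro e; apply h; exact ⟨d / n + 1, by linarith⟩
  have : d + 1 = (d % n + 1) + n * (d / n) := by linarith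
  rw [this, Int.add_mul_ediv_left _ _ hn.ne', Int.ediv_eq_zero_of_lt (by omega) (by omega)]
  rw [zero_add]

lemma div_pred_of_not_dvd {n d : ℤ} (hn : 0 < n) (h : ¬ n ∣ d) : (d - 1) / n = d / n := by
  have := div_succ_of_not_dvd (d := d - 1) hn (by simpa using h)
  rw [sub_add_cancel] at this; exact this.symm

lemma L_step {k : ℕ} (hk : 1 ≤ k) {w : Fin (k + 1) → ℤ} (h : Good k w) {x : Idx k}
    (hv : Valid k x w) (j : Fin (k + 1)) :
    Lw k (fun j => sact k x (w j)) j = Lw k w j + if (w j : Idx k) = x then 1 else 0 := by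
  obtain ⟨a, b, hab, ha, hb⟩ := hv
  have key : ∀ a b, (w a : Idx k) = w b → a = b := fun a b e => h.inj e
  have hn : (0 : ℤ) < (k : ℤ) + 1 := by positivity
  have hxx := xm1_ne hk x
  have hterm : ∀ m, ((sact k x (w m) - sact k x (w j)) / ((k : ℤ) + 1)).toNat =
      ((w m - w j) / ((k : ℤ) + 1)).toNat +
        if m = b then (if (w j : Idx k) = x then 1 else 0) else 0 := by
    intro m
    have hmb : m = b ↔ (w m : Idx k) = x - 1 :=
      ⟨fun e => by rw [e, hb], fun e => key _ _ (by rw [e, hb])⟩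
    have hja : (w j : Idx k) = x → j = a := fun e => key _ _ (by rw [e, ha])
    by_cases hmj : m = j
    · subst hmj
      simp only [sub_self, Int.zero_ediv, Int.toNat_zero, zero_add]
      split_ifs with h1 h2
      · exact absurd ((hmb.1 h1).symm.trans h2) hxx
      · rfl
      · rfl
    have hne : (w m : Idx k) ≠ w j := fun e => hmj (key _ _ e)
    have hnd : ¬ ((k : ℤ) + 1) ∣ w m - w j := by
      intro e; exact hne ((cast_eq_iff_dvd _ _).2 e).symm
    by_cases j1 : (w j : Idx k) = x
    · rw [sact_eq hk j1, if_pos j1]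
      by_cases m1 : (w m : Idx k) = x - 1
      · have := hmb.2 m1
        rw [sact_sub m1, if_pos this]
        have hlt : w j < w m := by
          rw [hja j1, this]; exact h.mono hab
        obtain ⟨c, hc⟩ : ((k : ℤ) + 1) ∣ w m - w j + 1 := by
          have := (cast_eq_iff_dvd (k := k) (w j) (w m + 1)).1 (by push_cast; rw [j1, m1]; ring)
          have e : w m - w j + 1 = w m + 1 - w j := by ring
          rwa [e]
        have hk' : (1 : ℤ) ≤ k := by exact_mod_cast hk
        have e1 : w m + 1 - (w j - 1) = 1 + ((k : ℤ) + 1) * c := by linarith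
        have e2 : w m - w j = (k : ℤ) + ((k : ℤ) + 1) * (c - 1) := by linarith
        have hc1 : 1 ≤ c := by
          by_contra hcon
          have : c ≤ 0 := by omega
          nlinarith
        rw [e1, e2, Int.add_mul_ediv_left _ _ hn.ne', Int.add_mul_ediv_left _ _ hn.ne',
          Int.ediv_eq_zero_of_lt (by omega) (by omega),
          Int.ediv_eq_zero_of_lt (by omega) (by omega)]
        omega
      · have m2 : (w m : Idx k) ≠ x := by rw [← j1]; exact hne
        rw [sact_fix m1 m2, if_neg (fun e => m1 (hmb.1 e))]
        have : w m - (w j - 1) = (w m - w j) + 1 := by ring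
        rw [this, div_succ_of_not_dvd hn]; · simp
        intro hd
        apply m1
        have := (cast_eq_iff_dvd (k := k) (w j) (w m + 1)).2 (by convert hd using 1; ring)
        push_cast at this
        rw [← j1, this]; ring
    · rw [if_neg j1]
      simp only [ite_self, add_zero]
      by_cases j2 : (w j : Idx k) = x - 1
      · rw [sact_sub j2]
        have m1 : (w m : Idx k) ≠ x - 1 := by rw [← j2]; exact hne
        by_cases m2 : (w m : Idx k) = x
        · rw [sact_eq hk m2]
          have e1 : m = a := key _ _ (by rw [m2, ha])
          have e2 : j = b := key _ _ (by rw [j2, hb])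
          have : w m < w j := by rw [e1, e2]; exact h.mono hab
          have a1 : (w m - 1 - (w j + 1)) / ((k : ℤ) + 1) < 0 :=
            Int.ediv_neg_of_neg_of_pos (by omega) hn
          have a2 : (w m - w j) / ((k : ℤ) + 1) < 0 :=
            Int.ediv_neg_of_neg_of_pos (by omega) hn
          omega
        · rw [sact_fix m1 m2]
          have : w m - (w j + 1) = (w m - w j) - 1 := by ring
          rw [this, div_pred_of_not_dvd hn hnd]
      · rw [sact_fix j2 j1]
        by_cases m1 : (w m : Idx k) = x - 1
        · rw [sact_sub m1]
          have : w m + 1 - w j = (w m - w j) + 1 := by ring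
          rw [this, div_succ_of_not_dvd hn]
          intro hd
          apply j1
          have := (cast_eq_iff_dvd (k := k) (w j) (w m + 1)).2 (by convert hd using 1)
          rw [this]; push_cast; rw [m1]; ring
        · by_cases m2 : (w m : Idx k) = x
          · rw [sact_eq hk m2]
            have : w m - 1 - w j = (w m - w j) - 1 := by ring
            rw [this, div_pred_of_not_dvd hn hnd]
          · rw [sact_fix m1 m2]
  unfold Lw
  rw [Finset.sum_congr rfl (fun m _ => hterm m), Finset.sum_add_distrib]
  simp

def wact (k : ℕ) (u : Word k) (w : Fin (k + 1) → ℤ) (j : Fin (k + 1)) : ℤ :=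
  u.foldr (sact k) (w j)

lemma wact_cons {k : ℕ} (x : Idx k) (b : Word k) (w : Fin (k + 1) → ℤ) (j : Fin (k + 1)) :
    wact k (x :: b) w j = sact k x (wact k b w j) := rfl

lemma wact_append {k : ℕ} (a b : Word k) (w : Fin (k + 1) → ℤ) :
    wact k (a ++ b) w = wact k a (wact k b w) := by
  funext j; simp [wact]

def ValidW (k : ℕ) : Word k → (Fin (k + 1) → ℤ) → Prop
  | [], _ => True
  | x :: b, w => ValidW k b w ∧ Valid k x (wact k b w)

lemma ValidW_append {k : ℕ} (a b : Word k) (w : Fin (k + 1) → ℤ) :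
    ValidW k (a ++ b) w ↔ ValidW k b w ∧ ValidW k a (wact k b w) := by
  induction a with
  | nil => simp [ValidW]
  | cons x a ih =>
    simp only [List.cons_append, ValidW, ih, wact_append]
    tauto

def cnt (k : ℕ) : Word k → (Fin (k + 1) → ℤ) → Fin (k + 1) → ℕ
  | [], _, _ => 0
  | x :: b, w, j => cnt k b w j + if (wact k b w j : Idx k) = x then 1 else 0

lemma cnt_append {k : ℕ} (a b : Word k) (w : Fin (k + 1) → ℤ) (j : Fin (k + 1)) :
    cnt k (a ++ b) w j = cnt k b w j + cnt k a (wact k b w) j := by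
  induction a with
  | nil => simp [cnt]
  | cons x a ih =>
    simp only [List.cons_append, cnt, ih, wact_append]
    omega

lemma Good.word {k : ℕ} (hk : 1 ≤ k) {w : Fin (k + 1) → ℤ} (h : Good k w) {u : Word k}
    (hv : ValidW k u w) : Good k (wact k u w) := by
  induction u with
  | nil => exact h
  | cons x b ih => exact (ih hv.1).step hk hv.2

lemma L_word {k : ℕ} (hk : 1 ≤ k) {w : Fin (k + 1) → ℤ} (h : Good k w) {u : Word k}
    (hv : ValidW k u w) (j : Fin (k + 1)) :
    Lw k (wact k u w) j = Lw k w j + cnt k u w j := by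
  induction u with
  | nil => rfl
  | cons x b ih =>
    have := L_step hk (h.word hk hv.1) hv.2 j
    simp only [cnt]
    rw [← add_assoc, ← ih hv.1, ← this]
    rfl

lemma cnt_sum {k : ℕ} (hk : 1 ≤ k) {w : Fin (k + 1) → ℤ} (h : Good k w) {u : Word k}
    (hv : ValidW k u w) : ∑ j, cnt k u w j = u.length := by
  induction u with
  | nil => simp [cnt]
  | cons x b ih =>
    simp only [cnt, Finset.sum_add_distrib, ih hv.1, List.length_cons]
    congr 1
    obtain ⟨j, m, -, hj, -⟩ := hv.2
    have : ∀ i, ((wact k b w i : Idx k) = x) ↔ i = j :=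
      fun i => ⟨fun e => (h.word hk hv.1).inj (by simp [e, hj]), fun e => by rw [e, hj]⟩
    simp [this]

/-- application-descending words -/
def Dsc (k : ℕ) (u : Word k) : Prop := u.Pairwise (fun a b => a ≠ b ∧ a ≠ b + 1)
/-- application-ascending words -/
def Asc (k : ℕ) (u : Word k) : Prop := u.Pairwise (fun a b => a ≠ b ∧ b ≠ a + 1)

/-- slot untouched -/
lemma untouched {k : ℕ} (hk : 1 ≤ k) {w : Fin (k + 1) → ℤ} {u : Word k} {p : Idx k}
    (h1 : p ∉ u) (h2 : p + 1 ∉ u) (j : Fin (k + 1)) (hj : (wact k u w j : Idx k) = p) :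
    wact k u w j = w j := by
  induction u with
  | nil => rfl
  | cons x b ih =>
    simp only [List.mem_cons, not_or] at h1 h2
    rw [wact_cons] at hj ⊢
    by_cases a1 : (wact k b w j : Idx k) = x - 1
    · rw [sact_cast_sub a1] at hj; exact absurd hj.symm h1.1
    · by_cases a2 : (wact k b w j : Idx k) = x
      · rw [sact_cast_eq hk a2] at hj
        exact absurd (by rw [← hj]; ring) h2.1
      · rw [sact_fix a1 a2] at hj ⊢
        exact ih h1.2 h2.2 hj

lemma untouched' {k : ℕ} (hk : 1 ≤ k) {w : Fin (k + 1) → ℤ} {u : Word k} {p : Idx k}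
    (h1 : p ∉ u) (h2 : p + 1 ∉ u) (j : Fin (k + 1)) (hj : (w j : Idx k) = p) :
    wact k u w j = w j := by
  induction u with
  | nil => rfl
  | cons x b ih =>
    simp only [List.mem_cons, not_or] at h1 h2
    rw [wact_cons, ih h1.2 h2.2]
    apply sact_fix
    · rw [hj]; intro e; exact h2.1 (by rw [e]; ring)
    · rw [hj]; exact h1.1

lemma desc_right {k : ℕ} (hk : 1 ≤ k) {w : Fin (k + 1) → ℤ} {u : Word k} (hd : Dsc k u)
    (m : Fin (k + 1)) : wact k u w m ≤ w m + 1 := by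
  induction u with
  | nil => simp [wact]
  | cons x b ih =>
    have hd' := List.pairwise_cons.1 hd
    rw [wact_cons]
    by_cases a1 : (wact k b w m : Idx k) = x - 1
    · rw [sact_sub a1, untouched hk _ _ m a1]
      · intro hx; exact (hd'.1 _ hx).2 (by ring)
      · intro hx; exact (hd'.1 _ hx).1 (by ring)
    · have := ih hd'.2
      by_cases a2 : (wact k b w m : Idx k) = x
      · rw [sact_eq hk a2]; omega
      · rw [sact_fix a1 a2]; exact this

lemma desc_left {k : ℕ} (hk : 1 ≤ k) {w : Fin (k + 1) → ℤ} (h : Good k w) {u : Word k}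
    (hd : Dsc k u) (hv : ValidW k u w) {a b : Fin (k + 1)} (hab : a < b) :
    w a + 1 ≤ wact k u w b := by
  induction u with
  | nil => exact h.mono hab
  | cons x c ih =>
    have hd' := List.pairwise_cons.1 hd
    have ih' := ih hd'.2 hv.1
    rw [wact_cons]
    by_cases a1 : (wact k c w b : Idx k) = x - 1
    · rw [sact_sub a1]; omega
    · by_cases a2 : (wact k c w b : Idx k) = x
      · rw [sact_eq hk a2]
        obtain ⟨j, m, hjm, hj, hm⟩ := hv.2
        have hbj : b = j := (h.word hk hv.1).inj (by simp [a2, hj])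
        have hum : wact k c w m = w m := by
          apply untouched hk _ _ m hm
          · intro hx; exact (hd'.1 _ hx).2 (by ring)
          · intro hx; exact (hd'.1 _ hx).1 (by ring)
        rcases ih'.lt_or_eq with h1 | h1
        · omega
        · exfalso
          have : (w a : Idx k) = w m := by
            rw [← hum, hm, ← a2, ← h1]; push_cast; ring
          have : a = m := h.inj this
          rw [hbj, this] at hab
          exact absurd hab (not_lt.2 hjm.le)
      · rw [sact_fix a1 a2]; exact ih'

lemma desc_vstrip {k : ℕ} (hk : 1 ≤ k) {w : Fin (k + 1) → ℤ} (h : Good k w) {u : Word k}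
    (hd : Dsc k u) (hv : ValidW k u w) {a b : Fin (k + 1)} (hab : a < b) :
    Lw k (wact k u w) b ≤ Lw k w a := by
  unfold Lw
  apply Finset.sum_le_sum
  intro m _
  apply Int.toNat_le_toNat
  apply Int.ediv_le_ediv (by positivity)
  have h1 := desc_right hk (w := w) hd m
  have h2 := desc_left hk h hd hv hab
  omega

lemma asc_cnt {k : ℕ} (hk : 1 ≤ k) {w : Fin (k + 1) → ℤ} {u : Word k}
    (hd : Asc k u) (j : Fin (k + 1)) :
    cnt k u w j = if (w j : Idx k) ∈ u then 1 else 0 := by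
  induction u with
  | nil => simp [cnt]
  | cons x b ih =>
    have hd' := List.pairwise_cons.1 hd
    have n1 : x ∉ b := fun hx => (hd'.1 _ hx).1 rfl
    have n2 : x + 1 ∉ b := fun hx => (hd'.1 _ hx).2 rfl
    have e : ((wact k b w j : Idx k) = x) ↔ (w j : Idx k) = x := by
      constructor
      · intro hh; rw [← untouched hk n1 n2 j hh, hh]
      · intro hh; rw [untouched' hk n1 n2 j hh, hh]
    simp only [cnt, ih hd'.2, e, List.mem_cons]
    by_cases h1 : (w j : Idx k) = x
    · simp [h1, n1]
    · simp [h1]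

lemma desc_touched_end {k : ℕ} (hk : 1 ≤ k) {w : Fin (k + 1) → ℤ} {u : Word k}
    (hd : Dsc k u) (j : Fin (k + 1)) (hj : 0 < cnt k u w j) :
    (wact k u w j : Idx k) ∉ u ∧ (wact k u w j : Idx k) + 1 ∈ u := by
  induction u with
  | nil => simp [cnt] at hj
  | cons x b ih =>
    have hd' := List.pairwise_cons.1 hd
    have n1 : x ∉ b := fun hx => (hd'.1 _ hx).1 rfl
    have n2 : x - 1 ∉ b := fun hx => (hd'.1 _ hx).2 (by ring)
    rw [wact_cons]
    by_cases h1 : (wact k b w j : Idx k) = x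
    · rw [sact_cast_eq hk h1]
      refine ⟨?_, by simp⟩
      simp only [List.mem_cons, not_or]
      exact ⟨xm1_ne hk x, n2⟩
    · simp only [cnt, h1, if_false, add_zero] at hj
      obtain ⟨i1, i2⟩ := ih hd'.2 hj
      have h2 : (wact k b w j : Idx k) ≠ x - 1 := by
        intro e; rw [e] at i2; apply n1; simpa using i2
      rw [sact_fix h2 h1]
      simp only [List.mem_cons, not_or]
      exact ⟨⟨h1, i1⟩, Or.inr i2⟩

lemma touched_of_slot {k : ℕ} {w : Fin (k + 1) → ℤ} {u : Word k} (hk : 1 ≤ k)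
    {y : Idx k} (h1 : y ∈ u) (h2 : y - 1 ∉ u) (j : Fin (k + 1))
    (hj : (wact k u w j : Idx k) = y - 1) : 0 < cnt k u w j := by
  induction u with
  | nil => simp at h1
  | cons x b ih =>
    simp only [List.mem_cons, not_or] at h1 h2
    rw [wact_cons] at hj
    simp only [cnt]
    by_cases a2 : (wact k b w j : Idx k) = x
    · simp [a2]
    · by_cases a1 : (wact k b w j : Idx k) = x - 1
      · rw [sact_cast_sub a1] at hj; exact absurd hj.symm h2.1
      · rw [sact_fix a1 a2] at hj
        rcases h1 with h1 | h1
        · subst h1; exact absurd hj a1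
        · have := ih h1 h2.2 hj; omega

lemma desc_touched_start {k : ℕ} (hk : 1 ≤ k) {w : Fin (k + 1) → ℤ} {u : Word k}
    (hd : Dsc k u) (j : Fin (k + 1)) (hj : 0 < cnt k u w j) :
    (w j : Idx k) ∈ u ∧ (w j : Idx k) + 1 ∉ u := by
  induction u with
  | nil => simp [cnt] at hj
  | cons x b ih =>
    have hd' := List.pairwise_cons.1 hd
    have n1 : x ∉ b := fun hx => (hd'.1 _ hx).1 rfl
    have n2 : x - 1 ∉ b := fun hx => (hd'.1 _ hx).2 (by ring)
    by_cases hb : 0 < cnt k b w j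
    · obtain ⟨i1, i2⟩ := ih hd'.2 hb
      simp only [List.mem_cons, not_or]
      refine ⟨Or.inr i1, ?_, i2⟩
      intro e; exact (hd'.1 _ i1).2 e.symm
    · have h1 : (wact k b w j : Idx k) = x := by
        by_contra h1
        simp only [cnt, h1, if_false, add_zero] at hj
        exact hb hj
      have n3 : x + 1 ∉ b := by
        intro hx
        apply hb
        apply touched_of_slot hk hx (by simpa using n1)
        simpa using h1
      have h2 := untouched hk n1 n3 j h1
      rw [h2] at h1
      rw [h1]
      simp only [List.mem_cons, not_or]
      refine ⟨Or.inl trivial, ?_, n3⟩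
      intro e; exact xm1_ne hk (x + 1) (by rw [add_sub_cancel_right]; exact e.symm)

lemma asc_slot {k : ℕ} (hk : 1 ≤ k) {w : Fin (k + 1) → ℤ} {u : Word k}
    (hd : Asc k u) (j : Fin (k + 1)) {p : Idx k} (hp : p + 1 ∈ u)
    (hj : (wact k u w j : Idx k) = p) : (w j : Idx k) = p + 1 := by
  induction u with
  | nil => simp at hp
  | cons x b ih =>
    have hd' := List.pairwise_cons.1 hd
    have n1 : x ∉ b := fun hx => (hd'.1 _ hx).1 rfl
    have n2 : x + 1 ∉ b := fun hx => (hd'.1 _ hx).2 rfl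
    rw [wact_cons] at hj
    by_cases a2 : (wact k b w j : Idx k) = x
    · rw [sact_cast_eq hk a2] at hj
      rw [← untouched hk n1 n2 j a2, a2, ← hj]; ring
    · by_cases a1 : (wact k b w j : Idx k) = x - 1
      · rw [sact_cast_sub a1] at hj
        subst hj
        rcases List.mem_cons.1 hp with h | h
        · exact absurd (by rw [add_sub_cancel_right]; exact h.symm) (xm1_ne hk (x + 1))
        · exact absurd h n2
      · rw [sact_fix a1 a2] at hj
        rcases List.mem_cons.1 hp with h | h
        · exfalso; apply a1; rw [hj, ← h]; ring
        · exact ih hd'.2 h hj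

lemma card_slots {k : ℕ} {w : Fin (k + 1) → ℤ} (h : Good k w) (l : Word k) (hl : l.Nodup) :
    (Finset.univ.filter (fun j => (w j : Idx k) ∈ l)).card = l.length := by
  rw [← List.toFinset_card_of_nodup hl]
  apply Finset.card_bij (fun j _ => (w j : Idx k))
  · intro a ha; simpa using ha
  · intro a _ b _ e; exact h.inj e
  · intro x hx
    obtain ⟨j, hj⟩ := h.surj x
    exact ⟨j, by simpa [hj] using hx, hj⟩

lemma Asc.nodup {k : ℕ} {u : Word k} (h : Asc k u) : u.Nodup :=
  List.Pairwise.imp (fun h => h.1) h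

/-- Conclusions for words of the form (ascending)(descending) in application order D then A. -/
lemma typeI {k : ℕ} (hk : 1 ≤ k) {w : Fin (k + 1) → ℤ} (h : Good k w) (ds as : Word k) (v : Idx k)
    (hd : Asc k ds) (ha : Dsc k (v :: as)) (hv : ValidW k (ds ++ v :: as) w)
    (hcon : ∀ p, p ∉ v :: as → p + 1 ∈ v :: as → p = v - 1 ∨ p ∈ ds) (hvd : v - 1 ∉ ds) :
    (Finset.univ.filter (fun j => 0 < cnt k (ds ++ v :: as) w j)).card = ds.length + 1 ∧
    ∀ a b, a < b → Lw k (wact k (ds ++ v :: as) w) b ≤ Lw k w a + 1 := by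
  rw [ValidW_append] at hv
  have hg := h.word hk hv.1
  constructor
  · have hnd : ((v - 1) :: ds).Nodup := List.nodup_cons.2 ⟨hvd, hd.nodup⟩
    rw [show ds.length + 1 = ((v - 1) :: ds).length from rfl, ← card_slots hg _ hnd]
    congr 1
    ext j
    simp only [Finset.mem_filter, Finset.mem_univ, true_and, cnt_append, asc_cnt hk hd,
      List.mem_cons]
    constructor
    · intro hj
      by_cases h1 : (wact k (v :: as) w j : Idx k) ∈ ds
      · exact Or.inr h1
      · simp only [h1, if_false, add_zero] at hj
        obtain ⟨e1, e2⟩ := desc_touched_end hk ha j hj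
        exact hcon _ e1 e2
    · rintro (hj | hj)
      · have : 0 < cnt k (v :: as) w j := by
          apply touched_of_slot hk (y := v) (by simp) _ j hj
          have ha' := List.pairwise_cons.1 ha
          simp only [List.mem_cons, not_or]
          exact ⟨xm1_ne hk v, fun hx => (ha'.1 _ hx).2 (by ring)⟩
        omega
      · simp [hj]
  · intro a b hab
    rw [wact_append, L_word hk hg hv.2, asc_cnt hk hd]
    have := desc_vstrip hk h ha hv.1 hab
    split_ifs <;> omega

lemma typeII {k : ℕ} (hk : 1 ≤ k) {w : Fin (k + 1) → ℤ} (h : Good k w) (ds as : Word k) (v : Idx k)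
    (hd : Dsc k (ds ++ [v])) (ha : Asc k as) (hv : ValidW k ((ds ++ [v]) ++ as) w)
    (hcon : ∀ p, p ∈ ds ++ [v] → p + 1 ∉ ds ++ [v] → p = v ∨ p + 1 ∈ as)
    (hva : v ∉ as) (hva' : v + 1 ∉ as) :
    (Finset.univ.filter (fun j => 0 < cnt k ((ds ++ [v]) ++ as) w j)).card = as.length + 1 ∧
    ∀ a b, a < b → Lw k (wact k ((ds ++ [v]) ++ as) w) b ≤ Lw k w a + 1 := by
  rw [ValidW_append] at hv
  have hg := h.word hk hv.1
  constructor
  · have hnd : (v :: as).Nodup := List.nodup_cons.2 ⟨hva, ha.nodup⟩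
    rw [show as.length + 1 = (v :: as).length from rfl, ← card_slots h _ hnd]
    congr 1
    ext j
    simp only [Finset.mem_filter, Finset.mem_univ, true_and, cnt_append _ as, asc_cnt hk ha]
    constructor
    · intro hj
      by_cases h1 : (w j : Idx k) ∈ as
      · exact List.mem_cons_of_mem _ h1
      · simp only [h1, if_false, zero_add] at hj
        obtain ⟨e1, e2⟩ := desc_touched_start hk hd j hj
        rcases hcon _ e1 e2 with h3 | h3
        · have := untouched hk hva hva' j h3
          rw [← this, h3]; simp
        · exact absurd (asc_slot hk ha j h3 rfl ▸ h3) h1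
    · intro hj
      rcases List.mem_cons.1 hj with hj | hj
      · have : wact k as w j = w j := untouched' hk hva hva' j hj
        have : 0 < cnt k (ds ++ [v]) (wact k as w) j := by
          rw [cnt_append]
          simp [cnt, wact]
          have e : (List.foldr (sact k) (w j) as) = w j := this
          simp [e, hj]
        omega
      · simp [hj]
  · intro a b hab
    rw [wact_append]
    have := desc_vstrip hk hg hd hv.2 hab
    rw [L_word hk h hv.1, asc_cnt hk ha] at this
    split_ifs at this <;> omega

/-! ### Part 2: Young diagrams and beads -/

lemma lower_ncard {A : Set ℕ} (hf : A.Finite) (hl : ∀ a ∈ A, ∀ b ≤ a, b ∈ A) (j : ℕ) :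
    j ∈ A ↔ j < A.ncard := by
  have key : ∃ N, A = Set.Iio N := by
    by_cases h : ∃ n, n ∉ A
    · refine ⟨Nat.find h, ?_⟩
      ext a
      simp only [Set.mem_Iio]
      constructor
      · intro ha
        by_contra hcon
        exact Nat.find_spec h (hl a ha _ (by omega))
      · intro ha
        by_contra hcon
        exact Nat.find_min h ha hcon
    · push Not at h
      exact absurd (hf.subset (fun a _ => h a : (Set.univ : Set ℕ) ⊆ A)) Set.infinite_univ
  obtain ⟨N, rfl⟩ := key
  simp [Set.ncard_eq_toFinset_card']

def row (S : Set Cell) (i : ℕ) : ℕ := {j | (i, j) ∈ S}.ncard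
def col (S : Set Cell) (j : ℕ) : ℕ := {i | (i, j) ∈ S}.ncard

lemma mem_row {S : Set Cell} (h : IsYoung S) (i j : ℕ) : (i, j) ∈ S ↔ j < row S i := by
  apply lower_ncard (A := {j | (i, j) ∈ S})
  · exact h.1.preimage (f := fun j => (i, j)) (fun a _ b _ e => by simpa using e)
  · intro a ha b hb; exact h.2 _ ha (i, b) le_rfl hb

lemma mem_col {S : Set Cell} (h : IsYoung S) (i j : ℕ) : (i, j) ∈ S ↔ i < col S j := by
  apply lower_ncard (A := {i | (i, j) ∈ S})
  · exact h.1.preimage (f := fun i => (i, j)) (fun a _ b _ e => by simpa using e)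
  · intro a ha b hb; exact h.2 _ ha (b, j) hb le_rfl

lemma row_eq {S : Set Cell} {i f : ℕ} (h : ∀ j, (i, j) ∈ S ↔ j < f) : row S i = f := by
  have : {j | (i, j) ∈ S} = Set.Iio f := by ext j; simp [h]
  rw [row, this]; simp [Set.ncard_eq_toFinset_card']

lemma row_anti {S : Set Cell} (h : IsYoung S) {i i' : ℕ} (hi : i ≤ i') : row S i' ≤ row S i := by
  by_contra hcon
  push Not at hcon
  have := (mem_row h i' (row S i)).2 hcon
  have := h.2 _ this (i, row S i) hi le_rfl
  rw [mem_row h] at this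
  omega

lemma col_anti {S : Set Cell} (h : IsYoung S) {i i' : ℕ} (hi : i ≤ i') : col S i' ≤ col S i := by
  by_contra hcon
  push Not at hcon
  have := (mem_col h (col S i) i').2 hcon
  have := h.2 _ this (col S i, i) le_rfl hi
  rw [mem_col h] at this
  omega

def bb (S : Set Cell) (i : ℕ) : ℤ := (row S i : ℤ) - i - 1
def gg (S : Set Cell) (j : ℕ) : ℤ := (j : ℤ) - col S j
def IsB (S : Set Cell) (p : ℤ) : Prop := ∃ i, p = bb S i

lemma bb_anti {S : Set Cell} (h : IsYoung S) {i i' : ℕ} (hi : i < i') : bb S i' < bb S i := by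
  have := row_anti h hi.le
  unfold bb; omega

lemma bb_inj {S : Set Cell} (h : IsYoung S) : Function.Injective (bb S) := by
  intro a b e
  rcases lt_trichotomy a b with h1 | h1 | h1
  · have := bb_anti h h1; omega
  · exact h1
  · have := bb_anti h h1; omega

lemma gg_inj {S : Set Cell} (h : IsYoung S) : Function.Injective (gg S) := by
  intro a b e
  unfold gg at e
  rcases lt_trichotomy a b with h1 | h1 | h1
  · have := col_anti h h1.le; omega
  · exact h1
  · have := col_anti h h1.le; omega

lemma mem_iff_gg_lt {S : Set Cell} (h : IsYoung S) (i j : ℕ) : (i, j) ∈ S ↔ gg S j < bb S i := by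
  have h1 := mem_row h i j
  have h2 := mem_col h i j
  unfold gg bb
  constructor
  · intro hm
    have := h1.1 hm; have := h2.1 hm; omega
  · intro hlt
    by_contra hm
    have : ¬ j < row S i := fun e => hm (h1.2 e)
    have : ¬ i < col S j := fun e => hm (h2.2 e)
    omega

lemma gg_not_B {S : Set Cell} (h : IsYoung S) (j : ℕ) : ¬ IsB S (gg S j) := by
  rintro ⟨i, hi⟩
  have h1 := mem_row h i j
  have h2 := mem_col h i j
  unfold gg bb at hi
  by_cases hm : (i, j) ∈ S
  · have := h1.1 hm; have := h2.1 hm; omega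
  · have : ¬ j < row S i := fun e => hm (h1.2 e)
    have : ¬ i < col S j := fun e => hm (h2.2 e)
    omega

lemma exists_gg {S : Set Cell} (h : IsYoung S) {p : ℤ} (hp : ¬ IsB S p) : ∃ j, p = gg S j := by
  have hex : ∃ i, bb S i < p := by
    refine ⟨row S 0 + p.natAbs, ?_⟩
    have := row_anti h (Nat.zero_le (row S 0 + p.natAbs))
    unfold bb; omega
  have h1 := Nat.find_spec hex
  have h0 : ∀ i, i < Nat.find hex → p < bb S i := by
    intro i hi
    have a := Nat.find_min hex hi
    have b : p ≠ bb S i := fun e => hp ⟨i, e⟩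
    omega
  set i0 := Nat.find hex
  have h2 : (row S i0 : ℤ) ≤ p + i0 := by unfold bb at h1; omega
  refine ⟨(p + i0).toNat, ?_⟩
  have hcol : col S (p + i0).toNat = i0 := by
    have a : ¬ i0 < col S (p + i0).toNat := by
      rw [← mem_col h, mem_row h]; omega
    have b : ∀ i, i < i0 → i < col S (p + i0).toNat := by
      intro i hi
      rw [← mem_col h, mem_row h]
      have e1 := h0 (i0 - 1) (by omega)
      have e2 := row_anti h (show i ≤ i0 - 1 by omega)
      unfold bb at e1; omega
    by_contra hne
    have := b (col S (p + i0).toNat) (by omega)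
    omega
  unfold gg
  rw [hcol]; omega

lemma hook_eq {S : Set Cell} (h : IsYoung S) {i j : ℕ} (hm : (i, j) ∈ S) :
    (hookLen S (i, j) : ℤ) = bb S i - gg S j := by
  have e1 : {j' | j < j' ∧ (i, j') ∈ S} = Set.Ioo j (row S i) := by
    ext a; simp [mem_row h]
  have e2 : {i' | i < i' ∧ (i', j) ∈ S} = Set.Ioo i (col S j) := by
    ext a; simp [mem_col h]
  have := (mem_row h i j).1 hm
  have := (mem_col h i j).1 hm
  simp only [hookLen, e1, e2]
  simp only [Set.ncard_eq_toFinset_card', Set.toFinset_Ioo, Nat.card_Ioo]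
  unfold bb gg
  omega

def prow (k : ℕ) (S : Set Cell) (i : ℕ) : ℕ := {j | (i, j) ∈ S ∧ hookLen S (i, j) ≤ k}.ncard

lemma prow_window {k : ℕ} {S : Set Cell} (h : IsYoung S) (i : ℕ) :
    prow k S i = {p : ℤ | bb S i - (k + 1) < p ∧ p < bb S i ∧ ¬ IsB S p}.ncard := by
  unfold prow
  rw [← Set.ncard_image_of_injective _ (gg_inj h)]
  congr 1
  ext p
  simp only [Set.mem_image, Set.mem_setOf_eq]
  constructor
  · rintro ⟨j, ⟨h1, h2⟩, rfl⟩
    have := hook_eq h h1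
    have := (mem_iff_gg_lt h i j).1 h1
    exact ⟨by omega, this, gg_not_B h j⟩
  · rintro ⟨h1, h2, h3⟩
    obtain ⟨j, rfl⟩ := exists_gg h h3
    have hm := (mem_iff_gg_lt h i j).2 h2
    have := hook_eq h hm
    exact ⟨j, ⟨hm, by omega⟩, rfl⟩

lemma core_down {k : ℕ} {S : Set Cell} (h : IsCore k S) {p : ℤ} (hp : IsB S p) :
    IsB S (p - (k + 1)) := by
  by_contra hcon
  obtain ⟨j, hj⟩ := exists_gg h.1 hcon
  obtain ⟨i, rfl⟩ := hp
  have hm := (mem_iff_gg_lt h.1 i j).2 (by omega)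
  have := hook_eq h.1 hm
  exact h.2 _ hm (by omega)

lemma core_downs {k : ℕ} {S : Set Cell} (h : IsCore k S) {p : ℤ} (hp : IsB S p) (c : ℕ) :
    IsB S (p - (k + 1) * c) := by
  induction c with
  | zero => simpa using hp
  | succ c ih =>
    have := core_down h ih
    convert this using 1
    push_cast; ring

def Rep (k : ℕ) (S : Set Cell) (w : Fin (k + 1) → ℤ) : Prop :=
  ∀ p : ℤ, IsB S p ↔ ∃ m, (w m : Idx k) = (p : Idx k) ∧ p < w m

lemma rep_core {k : ℕ} {S : Set Cell} (h : IsYoung S) {w : Fin (k + 1) → ℤ} (hr : Rep k S w) :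
    IsCore k S := by
  refine ⟨h, ?_⟩
  rintro ⟨i, j⟩ hm he
  have := hook_eq h hm
  obtain ⟨m, h1, h2⟩ := (hr _).1 ⟨i, rfl⟩
  apply gg_not_B h j
  rw [hr]
  refine ⟨m, ?_, by omega⟩
  rw [h1, cast_eq_iff_dvd]
  exact ⟨-1, by omega⟩

lemma exists_rep {k : ℕ} {S : Set Cell} (h : IsCore k S) : ∃ w, Good k w ∧ Rep k S w := by
  have hY := h.1
  have hlow : ∀ p : ℤ, p ≤ -(col S 0 : ℤ) - 1 → IsB S p := by
    intro p hp
    refine ⟨(-p - 1).toNat, ?_⟩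
    have : row S (-p - 1).toNat = 0 := by
      by_contra hne
      have := (mem_row hY (-p - 1).toNat 0).2 (by omega)
      rw [mem_col hY] at this
      omega
    unfold bb; rw [this]; omega
  have hhigh : ∀ p : ℤ, (row S 0 : ℤ) ≤ p → ¬ IsB S p := by
    rintro p hp ⟨i, hi⟩
    have := row_anti hY (Nat.zero_le i)
    unfold bb at hi; omega
  have hex : ∀ r : Idx k, ∃ t : ℤ, (t : Idx k) = r ∧ ¬ IsB S t ∧ IsB S (t - (k + 1)) := by
    intro r
    obtain ⟨z, rfl⟩ := ZMod.intCast_surjective r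
    set p0 : ℤ := z - (k + 1) * (col S 0 + 1 + z.natAbs) with hp0
    have hb0 : IsB S p0 := by
      apply hlow
      have : (0 : ℤ) ≤ k * (col S 0 + 1 + z.natAbs) := by positivity
      rw [hp0]; nlinarith [le_abs_self z, Int.natCast_natAbs z]
    have hexM : ∃ M : ℕ, ¬ IsB S (p0 + (k + 1) * M) := by
      refine ⟨(row S 0 + p0.natAbs), hhigh _ ?_⟩
      have : (0 : ℤ) ≤ k * (row S 0 + p0.natAbs) := by positivity
      push_cast
      nlinarith [neg_abs_le p0, Int.natCast_natAbs p0]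
    refine ⟨p0 + (k + 1) * (Nat.find hexM : ℕ), ?_, Nat.find_spec hexM, ?_⟩
    · rw [cast_eq_iff_dvd]
      exact ⟨(col S 0 + 1 + z.natAbs) - (Nat.find hexM : ℕ), by linear_combination -hp0⟩
    · have hpos : Nat.find hexM ≠ 0 := by
        intro e
        have := Nat.find_spec hexM
        rw [e] at this
        exact this (by simpa using hb0)
      have := Nat.find_min hexM (m := Nat.find hexM - 1) (by omega)
      rw [not_not] at this
      convert this using 1
      push_cast [Nat.cast_sub (show 1 ≤ Nat.find hexM by omega)]
      ring
  choose t ht1 ht2 ht3 using hex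
  have tinj : Function.Injective t := by
    intro a b e; rw [← ht1 a, ← ht1 b, e]
  let T : Finset ℤ := Finset.univ.image t
  have hT : T.card = k + 1 := by
    rw [Finset.card_image_of_injective _ tinj, Finset.card_univ, ZMod.card]
  let w : Fin (k + 1) → ℤ := fun j => T.orderEmbOfFin hT j
  have hw : ∀ j, w j = t (w j : Idx k) := by
    intro j
    have : w j ∈ T := T.orderEmbOfFin_mem hT j
    obtain ⟨r, -, hr⟩ := Finset.mem_image.1 this
    rw [← hr, ht1]
  have hw' : ∀ r, ∃ j, w j = t r := by
    intro r
    have : t r ∈ Set.range (T.orderEmbOfFin hT) := by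
      rw [Finset.range_orderEmbOfFin]; simp [T]
    obtain ⟨j, hj⟩ := this
    exact ⟨j, hj⟩
  have hmono : StrictMono w := (T.orderEmbOfFin hT).strictMono
  refine ⟨w, ⟨hmono, ?_⟩, ?_⟩
  · intro a b e
    apply hmono.injective
    rw [hw a, hw b]
    exact congrArg t e
  · have hn : (0 : ℤ) < (k : ℤ) + 1 := by positivity
    intro p
    constructor
    · intro hp
      obtain ⟨m, hm⟩ := hw' (p : Idx k)
      have hc : (w m : Idx k) = p := by rw [hm, ht1]
      refine ⟨m, hc, ?_⟩
      by_contra hcon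
      obtain ⟨c, hc⟩ := (cast_eq_iff_dvd _ _).1 hc
      have hc0 : 0 ≤ c := by
        by_contra h0
        have : c ≤ -1 := by omega
        nlinarith
      lift c to ℕ using hc0
      have := core_downs h hp c
      rw [← hc] at this
      apply ht2 (p : Idx k)
      rw [← hm]
      convert this using 1; ring
    · rintro ⟨m, hc, hlt⟩
      have hm : w m = t (p : Idx k) := by rw [← hc]; exact hw m
      obtain ⟨c, hc⟩ := (cast_eq_iff_dvd _ _).1 hc
      have hc0 : c + 1 ≤ 0 := by
        by_contra h0
        have : 0 ≤ c := by omega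
        nlinarith
      obtain ⟨d, hd⟩ := Int.eq_ofNat_of_zero_le (show 0 ≤ -(c + 1) by omega)
      have := core_downs h (ht3 (p : Idx k)) d
      rw [← hm, ← hd] at this
      convert this using 1
      linarith

lemma prow_eq {k : ℕ} {S : Set Cell} (h : IsYoung S) {w : Fin (k + 1) → ℤ} (hg : Good k w)
    (hr : Rep k S w) (i : ℕ) : {q | w q < bb S i}.ncard = prow k S i := by
  rw [prow_window h]
  have hn : (0 : ℤ) < (k : ℤ) + 1 := by positivity
  set b := bb S i with hb
  have hcast : ∀ q, ((b - 1 - (b - 1 - w q) % ((k : ℤ) + 1) : ℤ) : Idx k) = w q := by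
    intro q
    rw [cast_eq_iff_dvd]
    have := Int.emod_add_mul_ediv (b - 1 - w q) ((k : ℤ) + 1)
    exact ⟨-((b - 1 - w q) / ((k : ℤ) + 1)), by linarith⟩
  apply Set.ncard_congr (fun q _ => b - 1 - (b - 1 - w q) % ((k : ℤ) + 1))
  · intro q hq
    simp only [Set.mem_setOf_eq] at hq ⊢
    have h1 := Int.emod_nonneg (b - 1 - w q) hn.ne'
    have h2 := Int.emod_lt_of_pos (b - 1 - w q) hn
    have h3 : (b - 1 - w q) % ((k : ℤ) + 1) ≤ b - 1 - w q := by
      have e := Int.emod_add_mul_ediv (b - 1 - w q) ((k : ℤ) + 1)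
      have q0 := Int.ediv_nonneg (show 0 ≤ b - 1 - w q by omega) hn.le
      nlinarith
    have hnb : ¬ IsB S (b - 1 - (b - 1 - w q) % ((k : ℤ) + 1)) := by
      intro hB
      obtain ⟨m, hm1, hm2⟩ := (hr _).1 hB
      have : m = q := hg.inj (hm1.trans (hcast q))
      subst this; omega
    refine ⟨?_, by omega, hnb⟩
    by_contra hcon
    apply hnb
    have : b - 1 - (b - 1 - w q) % ((k : ℤ) + 1) = b - (k + 1) := by omega
    rw [this]
    exact core_down (rep_core h hr) ⟨i, rfl⟩
  · intro a c _ _ e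
    apply hg.inj
    show (w a : Idx k) = w c
    rw [← hcast a, ← hcast c, e]
  · rintro p ⟨h1, h2, h3⟩
    obtain ⟨q, hq⟩ := hg.surj (p : Idx k)
    have hle : w q ≤ p := by
      by_contra hcon
      exact h3 ((hr p).2 ⟨q, hq, by omega⟩)
    refine ⟨q, by simp only [Set.mem_setOf_eq]; omega, ?_⟩
    have : (b - 1 - w q) % ((k : ℤ) + 1) = b - 1 - p := by
      obtain ⟨c, hc⟩ := (cast_eq_iff_dvd _ _).1 hq
      have e : b - 1 - w q = (b - 1 - p) + ((k : ℤ) + 1) * c := by linarith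
      rw [e, Int.add_mul_emod_self_left, Int.emod_eq_of_lt (by omega) (by omega)]
    omega

lemma mem_pMap_iff {k : ℕ} {S : Set Cell} (h : IsYoung S) {w : Fin (k + 1) → ℤ} (hg : Good k w)
    (hr : Rep k S w) (i j : ℕ) : (i, j) ∈ pMap k S ↔ ∃ hj : j < k + 1, w ⟨j, hj⟩ < bb S i := by
  have e1 : (i, j) ∈ pMap k S ↔ j < prow k S i := Iff.rfl
  rw [e1, ← prow_eq h hg hr]
  have e2 : {q : Fin (k + 1) | w q < bb S i}.ncard =
      {j : ℕ | ∃ hj : j < k + 1, w ⟨j, hj⟩ < bb S i}.ncard := by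
    rw [← Set.ncard_image_of_injective _ Fin.val_injective]
    congr 1
    ext a
    simp only [Set.mem_image, Set.mem_setOf_eq]
    constructor
    · rintro ⟨q, hq, rfl⟩; exact ⟨q.2, hq⟩
    · rintro ⟨h1, h2⟩; exact ⟨⟨a, h1⟩, h2, rfl⟩
  rw [e2, ← lower_ncard]
  · rfl
  · exact (Set.finite_Iio (k + 1)).subset (fun a ha => ha.1)
  · rintro a ⟨h1, h2⟩ b hba
    refine ⟨by omega, lt_of_le_of_lt (hg.mono.monotone ?_) h2⟩
    exact hba

lemma lt_bb_iff {k : ℕ} {S : Set Cell} (h : IsYoung S) {w : Fin (k + 1) → ℤ} (hg : Good k w)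
    (hr : Rep k S w) (i : ℕ) (j : Fin (k + 1)) : w j < bb S i ↔ i < Lw k w j := by
  have hn : (0 : ℤ) < (k : ℤ) + 1 := by positivity
  let F : Finset (Σ _ : Fin (k + 1), ℕ) :=
    Finset.univ.sigma (fun m => Finset.range ((w m - w j) / ((k : ℤ) + 1)).toNat)
  let f : (Σ _ : Fin (k + 1), ℕ) → ℤ := fun x => w x.1 - (k + 1) * (x.2 + 1)
  have hF : ∀ (m : Fin (k + 1)) (q : ℕ), q < ((w m - w j) / ((k : ℤ) + 1)).toNat ↔
      w j < w m - (k + 1) * (q + 1) := by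
    intro m q
    have : q < ((w m - w j) / ((k : ℤ) + 1)).toNat ↔ (q : ℤ) + 1 ≤ (w m - w j) / ((k : ℤ) + 1) := by
      omega
    rw [this, Int.le_ediv_iff_mul_le hn]
    constructor
    · intro hle
      rcases hle.lt_or_eq with h1 | h1
      · linarith
      · exfalso
        have : j = m := hg.inj ((cast_eq_iff_dvd _ _).2 ⟨q + 1, by rw [← h1]; ring⟩)
        subst this
        have : (0 : ℤ) < (q + 1) * ((k : ℤ) + 1) := by positivity
        linarith
    · intro hlt; linarith
  have himg : bb S '' {i | w j < bb S i} = (F.image f : Finset ℤ) := by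
    ext p
    simp only [Set.mem_image, Set.mem_setOf_eq, Finset.coe_image, Finset.mem_coe]
    constructor
    · rintro ⟨i, hi, rfl⟩
      obtain ⟨m, hm1, hm2⟩ := (hr _).1 ⟨i, rfl⟩
      obtain ⟨c, hc⟩ := (cast_eq_iff_dvd _ _).1 hm1.symm
      have hc1 : 0 ≤ c - 1 := by
        by_contra h0
        have : c ≤ 0 := by omega
        nlinarith
      obtain ⟨d, hd⟩ := Int.eq_ofNat_of_zero_le hc1
      have hcd : c = (d : ℤ) + 1 := by omega
      subst hcd
      have e : w m - (k + 1) * ((d : ℤ) + 1) = bb S i := by linarith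
      refine ⟨⟨m, d⟩, ?_, e⟩
      simp only [F, Finset.mem_sigma, Finset.mem_univ, true_and, Finset.mem_range]
      rw [hF, e]; exact hi
    · rintro ⟨⟨m, q⟩, hmq, rfl⟩
      simp only [F, Finset.mem_sigma, Finset.mem_univ, true_and, Finset.mem_range] at hmq
      rw [hF] at hmq
      have : IsB S (f ⟨m, q⟩) := by
        rw [hr]
        refine ⟨m, ?_, ?_⟩
        · rw [cast_eq_iff_dvd]; exact ⟨-(q + 1), by simp only [f]; ring⟩
        · simp only [f]
          have : (0 : ℤ) < ((k : ℤ) + 1) * (q + 1) := by positivity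
          linarith
      obtain ⟨i, hi⟩ := this
      exact ⟨i, by rw [← hi]; exact hmq, hi.symm⟩
  have hfinj : Function.Injective f := by
    rintro ⟨m, q⟩ ⟨m', q'⟩ e
    simp only [f] at e
    have hmm : m = m' := hg.inj ((cast_eq_iff_dvd _ _).2 ⟨(q' : ℤ) - q, by linarith⟩)
    subst hmm
    have : ((k : ℤ) + 1) * (q + 1) = (k + 1) * (q' + 1) := by linarith
    have := mul_left_cancel₀ hn.ne' this
    have : q = q' := by omega
    rw [this]
  have hfin : {i | w j < bb S i}.Finite := by
    apply Set.Finite.of_finite_image _ (bb_inj h).injOn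
    rw [himg]; exact Finset.finite_toSet _
  have hcard : {i | w j < bb S i}.ncard = Lw k w j := by
    rw [← Set.ncard_image_of_injective _ (bb_inj h), himg, Set.ncard_coe_finset,
      Finset.card_image_of_injective _ hfinj, Finset.card_sigma]
    simp [Lw]
  rw [← hcard, ← lower_ncard hfin]
  · rfl
  · intro a ha b hba
    rcases hba.lt_or_eq with h1 | h1
    · exact lt_trans ha (bb_anti h h1)
    · rw [h1]; exact ha

lemma mem_pMap {k : ℕ} {S : Set Cell} (h : IsYoung S) {w : Fin (k + 1) → ℤ} (hg : Good k w)
    (hr : Rep k S w) (i j : ℕ) : (i, j) ∈ pMap k S ↔ ∃ hj : j < k + 1, i < Lw k w ⟨j, hj⟩ := by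
  rw [mem_pMap_iff h hg hr]
  simp only [lt_bb_iff h hg hr]

/-! ### Part 3: addable cells and the action -/

lemma addable_iff {S : Set Cell} (h : IsYoung S) (i j : ℕ) :
    Addable S (i, j) ↔ j = row S i ∧ ¬ IsB S (bb S i + 1) := by
  constructor
  · rintro ⟨h1, h2⟩
    have hj : row S i ≤ j := by
      by_contra hcon
      exact h1 ((mem_row h i j).2 (by omega))
    have hj2 : j = row S i := by
      have := h2.2 (i, j) (Or.inr rfl) (i, row S i) le_rfl hj
      rcases this with h3 | h3
      · rw [mem_row h] at h3; omega
      · simp only [Set.mem_singleton_iff, Prod.mk.injEq] at h3; exact h3.2.symm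
    refine ⟨hj2, ?_⟩
    rintro ⟨i', hi'⟩
    have hlt : i' < i := by
      by_contra hcon
      rcases (not_lt.1 hcon).lt_or_eq with h4 | h4
      · have := bb_anti h h4; omega
      · subst h4; omega
    have := h2.2 (i, j) (Or.inr rfl) (i', j) hlt.le le_rfl
    rcases this with h3 | h3
    · rw [mem_row h] at h3; unfold bb at hi'; omega
    · simp only [Set.mem_singleton_iff, Prod.mk.injEq] at h3; omega
  · rintro ⟨rfl, hB⟩
    refine ⟨fun hm => ?_, h.1.union (Set.finite_singleton _), ?_⟩
    · rw [mem_row h] at hm; omega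
    · rintro p (hp | hp) ⟨a, b⟩ h1 h2
      · exact Or.inl (h.2 p hp _ h1 h2)
      · simp only [Set.mem_singleton_iff] at hp
        subst hp
        simp only at h1 h2
        rcases h1.lt_or_eq with h3 | h3
        · left
          rw [mem_row h]
          have e1 := row_anti h (show a ≤ i - 1 by omega)
          have e2 := row_anti h (show i - 1 ≤ i by omega)
          have e3 : row S (i - 1) ≠ row S i := by
            intro e
            apply hB
            refine ⟨i - 1, ?_⟩
            unfold bb; rw [e]; omega
          omega
        · subst h3
          rcases h2.lt_or_eq with h4 | h4
          · left; exact (mem_row h _ _).2 h4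
          · right; rw [h4]; rfl

lemma res_addable {k : ℕ} (S : Set Cell) (i : ℕ) : res k (i, row S i) = ((bb S i + 1 : ℤ) : Idx k) := by
  simp [res, bb]

def addSet (k : ℕ) (x : Idx k) (S : Set Cell) : Set Cell := S ∪ {c | Addable S c ∧ res k c = x}

lemma dotC_some {k : ℕ} {x : Idx k} {S S' : Set Cell} (h : dotC k x (some S) = some S') :
    (∃ c, Addable S c ∧ res k c = x) ∧ S' = addSet k x S := by
  unfold dotC at h
  simp only at h
  split_ifs at h with hc
  exact ⟨hc, (Option.some.inj h).symm⟩

lemma addSet_young {k : ℕ} {x : Idx k} {S : Set Cell} (h : IsYoung S) : IsYoung (addSet k x S) := by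
  refine ⟨?_, ?_⟩
  · apply h.1.union
    apply ((h.1.image (fun c : Cell => (c.1 + 1, c.2))).union (Set.finite_singleton (0, row S 0))).subset
    rintro ⟨i, j⟩ ⟨hc, -⟩
    rcases Nat.eq_zero_or_pos i with h0 | h0
    · subst h0
      right
      rw [addable_iff h] at hc
      rw [hc.1]; rfl
    · left
      have := hc.2.2 (i, j) (Or.inr rfl) (i - 1, j) (by simp) le_rfl
      rcases this with h3 | h3
      · exact ⟨_, h3, by simp; omega⟩
      · simp only [Set.mem_singleton_iff, Prod.mk.injEq] at h3; omega
  · rintro p (hp | hp) q h1 h2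
    · exact Or.inl (h.2 p hp q h1 h2)
    · rcases hp.1.2.2 p (Or.inr rfl) q h1 h2 with h3 | h3
      · exact Or.inl h3
      · rw [Set.mem_singleton_iff] at h3; subst h3; exact Or.inr hp

def dlt (k : ℕ) (x : Idx k) (S : Set Cell) (i : ℕ) : ℕ :=
  if ¬ IsB S (bb S i + 1) ∧ ((bb S i + 1 : ℤ) : Idx k) = x then 1 else 0

lemma addSet_bb {k : ℕ} {x : Idx k} {S : Set Cell} (h : IsYoung S) (i : ℕ) :
    bb (addSet k x S) i = bb S i + dlt k x S i := by
  have : row (addSet k x S) i = row S i + dlt k x S i := by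
    apply row_eq
    intro j
    unfold addSet dlt
    simp only [Set.mem_union, Set.mem_setOf_eq, addable_iff h, mem_row h]
    constructor
    · rintro (h1 | ⟨⟨rfl, h2⟩, h3⟩)
      · omega
      · rw [res_addable] at h3
        rw [if_pos ⟨h2, h3⟩]; omega
    · intro hj
      split_ifs at hj with hc
      · rcases (Nat.lt_succ_iff.1 hj).lt_or_eq with h1 | h1
        · exact Or.inl h1
        · right; subst h1
          exact ⟨⟨rfl, hc.1⟩, by rw [res_addable]; exact hc.2⟩
      · left; omega
  unfold bb; rw [this]; push_cast; ring

lemma addSet_valid {k : ℕ} (hk : 1 ≤ k) {x : Idx k} {S : Set Cell} (h : IsYoung S)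
    {w : Fin (k + 1) → ℤ} (hg : Good k w) (hr : Rep k S w)
    (hex : ∃ c, Addable S c ∧ res k c = x) : Valid k x w := by
  obtain ⟨⟨i, j⟩, hc, hx⟩ := hex
  rw [addable_iff h] at hc
  obtain ⟨rfl, hB⟩ := hc
  rw [res_addable] at hx
  obtain ⟨m, hm1, hm2⟩ := (hr _).1 ⟨i, rfl⟩
  obtain ⟨j, hj⟩ := hg.surj x
  have hm3 : (w m : Idx k) = x - 1 := by rw [hm1, ← hx]; push_cast; ring
  refine ⟨j, m, ?_, hj, hm3⟩
  have h1 : w j ≤ bb S i + 1 := by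
    by_contra hcon
    exact hB ((hr _).2 ⟨j, by rw [hj, hx], by omega⟩)
  have h2 : w j ≠ w m := by
    intro e
    apply xm1_ne hk x
    rw [← hm3, ← hj, e]
  exact hg.mono.lt_iff_lt.1 (by omega)

lemma addSet_isB {k : ℕ} (hk : 1 ≤ k) {x : Idx k} {S : Set Cell} (h : IsYoung S)
    {w : Fin (k + 1) → ℤ} (hg : Good k w) (hr : Rep k S w) (hv : Valid k x w) (p : ℤ) :
    IsB (addSet k x S) p ↔ IsB S (sact k x p) := by
  have hst : ∀ q : ℤ, (q : Idx k) = x → IsB S q → IsB S (q - 1) := by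
    intro q hq hB
    obtain ⟨j, m, hjm, hj, hm⟩ := hv
    obtain ⟨j', h1, h2⟩ := (hr _).1 hB
    have : j' = j := hg.inj (by show (w j' : Idx k) = w j; rw [h1, hj, hq])
    subst this
    have := hg.mono hjm
    exact (hr _).2 ⟨m, by rw [hm, ← hq]; push_cast; ring, by omega⟩
  have hne := xm1_ne hk x
  have hd1 : ∀ i, IsB S (bb S i + 1) → bb (addSet k x S) i = bb S i := by
    intro i hi; rw [addSet_bb h, dlt, if_neg (fun hh => hh.1 hi)]; simp
  have hd2 : ∀ i, ((bb S i : ℤ) : Idx k) ≠ x - 1 → bb (addSet k x S) i = bb S i := by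
    intro i hi; rw [addSet_bb h, dlt, if_neg]; · simp
    rintro ⟨-, h2⟩; apply hi; rw [← h2]; push_cast; ring
  have hd3 : ∀ i, bb (addSet k x S) i = bb S i ∨ (bb (addSet k x S) i = bb S i + 1 ∧
      ((bb S i : ℤ) : Idx k) = x - 1) := by
    intro i
    rw [addSet_bb h, dlt]
    split_ifs with hc
    · right; refine ⟨by simp, ?_⟩; rw [← hc.2]; push_cast; ring
    · left; simp
  have hd4 : ∀ i, ((bb S i : ℤ) : Idx k) = x - 1 → ¬ IsB S (bb S i + 1) →
      bb (addSet k x S) i = bb S i + 1 := by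
    intro i h1 h2
    rw [addSet_bb h, dlt, if_pos ⟨h2, by push_cast; rw [h1]; ring⟩]; simp
  by_cases h1 : (p : Idx k) = x - 1
  · rw [sact_sub h1]
    constructor
    · rintro ⟨i, rfl⟩
      rcases hd3 i with h2 | ⟨h2, h3⟩
      · by_contra hcon
        rw [h2] at h1 hcon
        have := hd4 i h1 hcon
        omega
      · rw [h2] at h1; push_cast at h1; rw [h3] at h1
        exact absurd (by linear_combination -h1) hne
    · intro hB
      have := hst (p + 1) (by push_cast; rw [h1]; ring) hB
      obtain ⟨i, hi⟩ := this
      refine ⟨i, ?_⟩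
      rw [hd1 i (by rw [← hi]; simpa using hB)]; omega
  · by_cases h2 : (p : Idx k) = x
    · rw [sact_eq hk h2]
      constructor
      · rintro ⟨i, rfl⟩
        rcases hd3 i with h3 | ⟨h3, -⟩
        · rw [h3] at h2 ⊢
          exact hst _ h2 ⟨i, rfl⟩
        · exact ⟨i, by omega⟩
      · rintro ⟨i, hi⟩
        have hi' : bb S i + 1 = p := by omega
        by_cases hB : IsB S p
        · obtain ⟨i', rfl⟩ := hB
          exact ⟨i', (hd2 i' h1).symm⟩
        · refine ⟨i, ?_⟩
          rw [hd4 i]; · omega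
          · rw [← hi]; push_cast; rw [h2]
          · rw [hi']; exact hB
    · rw [sact_fix h1 h2]
      constructor
      · rintro ⟨i, rfl⟩
        rcases hd3 i with h3 | ⟨h3, h4⟩
        · exact ⟨i, h3⟩
        · exfalso; apply h2; rw [h3]; push_cast; rw [h4]; ring
      · rintro ⟨i, rfl⟩
        exact ⟨i, (hd2 i h1).symm⟩

lemma addSet_rep {k : ℕ} (hk : 1 ≤ k) {x : Idx k} {S : Set Cell} (h : IsYoung S)
    {w : Fin (k + 1) → ℤ} (hg : Good k w) (hr : Rep k S w) (hv : Valid k x w) :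
    Rep k (addSet k x S) (fun j => sact k x (w j)) := by
  intro p
  rw [addSet_isB hk h hg hr hv, hr]
  apply exists_congr
  intro m
  have key : ∀ q : ℤ, (w m : Idx k) = (q : Idx k) → (sact k x (w m) - sact k x q = w m - q) := by
    intro q hq
    obtain ⟨c, hc⟩ := (cast_eq_iff_dvd _ _).1 hq.symm
    have : w m = q + ((k : ℤ) + 1) * c := by linarith
    rw [this, sact_shift]; ring
  constructor
  · rintro ⟨h1, h2⟩
    have := key _ h1
    rw [sact_sact hk] at this
    have h3 := sact_cast_congr x _ _ h1
    rw [sact_sact hk] at h3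
    exact ⟨h3, by show p < sact k x (w m); omega⟩
  · rintro ⟨h1, h2⟩
    change p < sact k x (w m) at h2
    have h3 := sact_cast_congr x _ _ h1
    rw [sact_sact hk] at h3
    have := key _ h3
    rw [sact_sact hk] at this
    exact ⟨h3, by omega⟩

lemma dotCW_cons {k : ℕ} {x : Idx k} {b : Word k} {S S' : Set Cell}
    (h : dotCW k (x :: b) (some S) = some S') :
    ∃ T, dotCW k b (some S) = some T ∧ (∃ c, Addable T c ∧ res k c = x) ∧ S' = addSet k x T := by
  have e : dotCW k (x :: b) (some S) = dotC k x (dotCW k b (some S)) := rfl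
  rw [e] at h
  cases hT : dotCW k b (some S) with
  | none => rw [hT] at h; simp [dotC] at h
  | some T =>
    rw [hT] at h
    exact ⟨T, rfl, dotC_some h⟩

lemma dotCW_rep {k : ℕ} (hk : 1 ≤ k) {S : Set Cell} (h : IsYoung S)
    {w : Fin (k + 1) → ℤ} (hg : Good k w) (hr : Rep k S w) (u : Word k) (S' : Set Cell)
    (hu : dotCW k u (some S) = some S') :
    ValidW k u w ∧ IsYoung S' ∧ Rep k S' (wact k u w) := by
  induction u generalizing S' with
  | nil =>
    have : S = S' := Option.some.inj hu
    subst this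
    exact ⟨trivial, h, hr⟩
  | cons x b ih =>
    obtain ⟨T, hT, hex, rfl⟩ := dotCW_cons hu
    obtain ⟨h1, h2, h3⟩ := ih T hT
    have hg' := hg.word hk h1
    have hv := addSet_valid hk h2 hg' h3 hex
    exact ⟨⟨h1, hv⟩, addSet_young h2, addSet_rep hk h2 hg' h3 hv⟩

lemma pMap_word {k : ℕ} (hk : 1 ≤ k) {S : Set Cell} (h : IsYoung S)
    {w : Fin (k + 1) → ℤ} (hg : Good k w) (hr : Rep k S w) (u : Word k) (S' : Set Cell)
    (hu : dotCW k u (some S) = some S') (i j : ℕ) :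
    (i, j) ∈ pMap k S' ↔ ∃ hj : j < k + 1, i < Lw k w ⟨j, hj⟩ + cnt k u w ⟨j, hj⟩ := by
  obtain ⟨h1, h2, h3⟩ := dotCW_rep hk h hg hr u S' hu
  rw [mem_pMap h2 (hg.word hk h1) h3]
  simp only [L_word hk hg h1]

/-! ### Part 4: the bijection -/

lemma inj_aux {k : ℕ} {S S' : Set Cell} (h : IsCore k S) (h' : IsCore k S') (i : ℕ)
    (hag : ∀ i', i < i' → bb S i' = bb S' i') (hlt : bb S i < bb S' i) :
    prow k S i < prow k S' i := by
  have hY := h.1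
  have hY' := h'.1
  rw [prow_window hY, prow_window hY']
  have hnb : ∀ p, bb S i ≤ p → p < bb S' i → ¬ IsB S' p := by
    rintro p h1 h2 ⟨a, rfl⟩
    have ha : i < a := by
      by_contra hcon
      rcases (not_lt.1 hcon).lt_or_eq with h4 | h4
      · have := bb_anti hY' h4; omega
      · subst h4; omega
    have := hag a ha
    have := bb_anti hY ha
    omega
  have hsame : ∀ p, p < bb S i → IsB S' p → IsB S p := by
    rintro p h1 ⟨a, rfl⟩
    have ha : i < a := by
      by_contra hcon
      rcases (not_lt.1 hcon).lt_or_eq with h4 | h4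
      · have := bb_anti hY' h4; omega
      · subst h4; omega
    exact ⟨a, (hag a ha).symm⟩
  have hd : IsB S' (bb S' i - (k + 1)) := core_down h' ⟨i, rfl⟩
  have hlt2 : bb S' i - (k + 1) < bb S i := by
    by_contra hcon
    exact hnb _ (not_lt.1 hcon) (by omega) hd
  set b := bb S i
  set b' := bb S' i
  let f : ℤ → ℤ := fun p => if b' - (k + 1) < p then p else p + (k + 1)
  have hinj : Set.InjOn f {p : ℤ | b - (k + 1) < p ∧ p < b ∧ ¬ IsB S p} := by
    rintro p ⟨h1, h2, -⟩ q ⟨h3, h4, -⟩ e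
    simp only [f] at e
    split_ifs at e <;> omega
  rw [← Set.ncard_image_of_injOn hinj]
  apply Set.ncard_lt_ncard
  · refine ⟨?_, ?_⟩
    · rintro _ ⟨p, ⟨h1, h2, h3⟩, rfl⟩
      simp only [f]
      split_ifs with hc
      · exact ⟨hc, by omega, fun hB => h3 (hsame p h2 hB)⟩
      · have : p ≠ b' - (k + 1) := by
          rintro rfl
          exact h3 (hsame _ h2 hd)
        exact ⟨by omega, by omega, hnb _ (by omega) (by omega)⟩
    · intro hsub
      obtain ⟨p, ⟨h1, h2, h3⟩, e⟩ := hsub (show b ∈ _ from ⟨hlt2, hlt, hnb b le_rfl hlt⟩)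
      simp only [f] at e
      split_ifs at e <;> omega
  · exact (Set.finite_Ioo (b' - (k + 1)) b').subset (fun p hp => ⟨hp.1, hp.2.1⟩)

lemma prow_of_pMap {k : ℕ} {S S' : Set Cell} (e : pMap k S = pMap k S') (i : ℕ) :
    prow k S i = prow k S' i := by
  have : ∀ j, j < prow k S i ↔ j < prow k S' i := by
    intro j
    have e1 : (i, j) ∈ pMap k S ↔ j < prow k S i := Iff.rfl
    have e2 : (i, j) ∈ pMap k S' ↔ j < prow k S' i := Iff.rfl
    rw [← e1, ← e2, e]
  have h1 := this (prow k S i)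
  have h2 := this (prow k S' i)
  omega

lemma pMap_inj {k : ℕ} {S S' : Set Cell} (h : IsCore k S) (h' : IsCore k S')
    (e : pMap k S = pMap k S') : S = S' := by
  have hz : ∀ {T : Set Cell}, IsYoung T → ∀ i, col T 0 ≤ i → row T i = 0 := by
    intro T hT i hi
    by_contra hne
    have := (mem_row hT i 0).2 (by omega)
    rw [mem_col hT] at this
    omega
  have key : ∀ d i, max (col S 0) (col S' 0) ≤ i + d → bb S i = bb S' i := by
    intro d
    induction d with
    | zero =>
      intro i hi
      have h1 := hz h.1 i (by omega)
      have h2 := hz h'.1 i (by omega)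
      unfold bb; rw [h1, h2]
    | succ d ih =>
      intro i hi
      have hag : ∀ i', i < i' → bb S i' = bb S' i' := fun i' hi' => ih i' (by omega)
      have := prow_of_pMap e i
      rcases lt_trichotomy (bb S i) (bb S' i) with h1 | h1 | h1
      · have := inj_aux h h' i hag h1; omega
      · exact h1
      · have := inj_aux h' h i (fun i' hi' => (hag i' hi').symm) h1; omega
  ext ⟨i, j⟩
  rw [mem_row h.1, mem_row h'.1]
  have := key _ i (Nat.le_add_left _ i)
  unfold bb at this
  omega

lemma surj_rank {k : ℕ} {w : Fin (k + 1) → ℤ} (hg : Good k w)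
    (m j : Fin (k + 1)) (hjk : (j : ℕ) < k) (hmj : m < j)
    (hL : Lw k w m = Lw k w j + 1) : (w m : Idx k) ≠ (w j : Idx k) - 1 := by
  intro hc
  have hn : (0 : ℤ) < (k : ℤ) + 1 := by positivity
  have hlt := hg.mono hmj
  have hc' : (w m : Idx k) = ((w j - 1 : ℤ) : Idx k) := by push_cast; exact hc
  obtain ⟨e, he⟩ := (cast_eq_iff_dvd _ _).1 hc'
  have he0 : 0 ≤ e := by
    by_contra h0
    have : e ≤ -1 := by omega
    nlinarith
  rcases he0.lt_or_eq with h1 | h1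
  · let z : Fin (k + 1) := Fin.last k
    have hjz : j < z := by show (j : ℕ) < k; exact hjk
    have hge : ∀ q, ((w q - w j) / ((k : ℤ) + 1)) + 1 ≤ (w q - w m) / ((k : ℤ) + 1) := by
      intro q
      rw [Int.le_ediv_iff_mul_le hn]
      have := Int.ediv_mul_le (w q - w j) hn.ne'
      nlinarith
    have hge2 : ∀ q, j ≤ q → 0 ≤ (w q - w j) / ((k : ℤ) + 1) := by
      intro q hq
      apply Int.ediv_nonneg _ hn.le
      have := hg.mono.monotone hq
      omega
    have : Lw k w j + 2 ≤ Lw k w m := by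
      have e1 : Lw k w j + 2 = ∑ q, (((w q - w j) / ((k : ℤ) + 1)).toNat +
          ((if q = j then 1 else 0) + (if q = z then 1 else 0))) := by
        rw [Finset.sum_add_distrib, Finset.sum_add_distrib]
        simp [Lw]
      rw [e1]
      unfold Lw
      apply Finset.sum_le_sum
      intro q _
      have a1 := hge q
      by_cases hqj : q = j
      · have hqz : q ≠ z := by rw [hqj]; exact hjz.ne
        have := hge2 q (by rw [hqj])
        rw [if_pos hqj, if_neg hqz]; omega
      · by_cases hqz : q = z
        · have := hge2 q (by rw [hqz]; exact hjz.le)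
          rw [if_neg hqj, if_pos hqz]; omega
        · rw [if_neg hqj, if_neg hqz]; omega
    omega
  · have hw : w j = w m + 1 := by rw [← h1] at he; omega
    have : Lw k w m = Lw k w j := by
      unfold Lw
      apply Finset.sum_congr rfl
      intro q _
      by_cases hd : ((k : ℤ) + 1) ∣ w q - w m
      · have : m = q := hg.inj ((cast_eq_iff_dvd _ _).2 hd)
        subst this
        rw [hw, sub_self, show w m - (w m + 1) = -1 by ring]
        have : (-1 : ℤ) / ((k : ℤ) + 1) < 0 := Int.ediv_neg_of_neg_of_pos (by norm_num) hn
        simp; omega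
      · rw [hw, show w q - (w m + 1) = (w q - w m) - 1 by ring, div_pred_of_not_dvd hn hd]
    omega

lemma pMap_surj {k : ℕ} (hk : 1 ≤ k) (N : ℕ) : ∀ lam : Set Cell, IsBounded k lam →
    lam.ncard = N → ∃ S, IsCore k S ∧ pMap k S = lam := by
  induction N with
  | zero =>
    intro lam hb hN
    have : lam = ∅ := by
      rwa [Set.ncard_eq_zero hb.1.1] at hN
    subst this
    refine ⟨∅, ⟨⟨Set.finite_empty, by simp⟩, by simp⟩, ?_⟩
    ext c; simp [pMap]
  | succ N ih =>
    intro lam hb hN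
    have hY := hb.1
    have hne : lam.Nonempty := by
      rw [← Set.ncard_pos hY.1]; omega
    obtain ⟨c0, hc0⟩ := hne
    have h00 : (0, 0) ∈ lam := hY.2 c0 hc0 (0, 0) (Nat.zero_le _) (Nat.zero_le _)
    have hcol : 0 < col lam 0 := (mem_col hY 0 0).1 h00
    obtain ⟨i, hi⟩ : ∃ i, col lam 0 = i + 1 := ⟨col lam 0 - 1, by omega⟩
    have hi0 : (i, 0) ∈ lam := (mem_col hY i 0).2 (by omega)
    have hrow : 0 < row lam i := (mem_row hY i 0).1 hi0
    obtain ⟨j, hj⟩ : ∃ j, row lam i = j + 1 := ⟨row lam i - 1, by omega⟩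
    have hij : (i, j) ∈ lam := (mem_row hY i j).2 (by omega)
    have hmax : ∀ a b, (a, b) ∈ lam → a ≤ i := by
      intro a b hab
      have := hY.2 _ hab (a, 0) le_rfl (Nat.zero_le _)
      rw [mem_col hY] at this; omega
    have hjk : j < k := hb.2 _ hij
    have hb' : IsBounded k (lam \ {(i, j)}) := by
      refine ⟨⟨hY.1.diff, ?_⟩, fun c hc => hb.2 c hc.1⟩
      rintro ⟨a, b⟩ ⟨hp1, hp2⟩ q h1 h2
      refine ⟨hY.2 _ hp1 q h1 h2, ?_⟩
      rintro hq
      rw [Set.mem_singleton_iff] at hq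
      subst hq
      simp only at h1 h2
      have ha := hmax a b hp1
      have : a = i := le_antisymm ha h1
      subst this
      have := (mem_row hY a b).1 hp1
      have : b = j := by omega
      subst this
      exact hp2 rfl
    obtain ⟨S, hS, hpS⟩ := ih _ hb' (by
      rw [Set.ncard_diff_singleton_of_mem hij, hN]; rfl)
    obtain ⟨w, hg, hr⟩ := exists_rep hS
    have hmem := mem_pMap hS.1 hg hr
    rw [hpS] at hmem
    let J : Fin (k + 1) := ⟨j, by omega⟩
    have hLJ : Lw k w J = i := by
      have h1 : ¬ i < Lw k w J := by
        intro hh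
        exact ((hmem i j).2 ⟨J.2, hh⟩).2 rfl
      have h2 : i ≤ Lw k w J := by
        rcases Nat.eq_zero_or_pos i with h0 | h0
        · omega
        · have : (i - 1, j) ∈ lam \ {(i, j)} :=
            ⟨hY.2 _ hij _ (Nat.sub_le _ _) le_rfl, by simp; omega⟩
          obtain ⟨_, h3⟩ := (hmem _ _).1 this
          have h3 : i - 1 < Lw k w J := h3
          omega
      omega
    obtain ⟨m, hm⟩ := hg.surj ((w J : Idx k) - 1)
    have hJm : J < m := by
      rcases lt_trichotomy m J with h1 | h1 | h1
      · exfalso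
        have hmj : (m : ℕ) < j := h1
        have h2 : (i, (m : ℕ)) ∈ lam \ {(i, j)} :=
          ⟨(mem_row hY _ _).2 (by omega), by simp; omega⟩
        obtain ⟨_, h3⟩ := (hmem _ _).1 h2
        have h3 : i < Lw k w m := h3
        have h4 : ¬ i + 1 < Lw k w m := by
          intro hh
          have := ((hmem (i + 1) m).2 ⟨m.2, hh⟩).1
          have := hmax _ _ this
          omega
        exact surj_rank hg m J hjk h1 (by omega) hm
      · exfalso; rw [h1] at hm; exact xm1_ne hk _ hm.symm
      · exact h1
    have hlt := hg.mono hJm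
    have hex : ∃ c, Addable S c ∧ res k c = (w J : Idx k) := by
      obtain ⟨a, ha⟩ : IsB S (w J - 1) := (hr _).2 ⟨m, by rw [hm]; push_cast; ring, by omega⟩
      have ha' : bb S a + 1 = w J := by omega
      refine ⟨(a, row S a), ?_, ?_⟩
      · rw [addable_iff hS.1]
        refine ⟨rfl, ?_⟩
        rw [ha', hr]
        rintro ⟨q, hq1, hq2⟩
        have : q = J := hg.inj hq1
        subst this; omega
      · rw [res_addable, ha']
    have hv : Valid k (w J : Idx k) w := ⟨J, m, hJm, rfl, hm⟩
    have hY2 := addSet_young (k := k) (x := (w J : Idx k)) hS.1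
    have hr2 := addSet_rep hk hS.1 hg hr hv
    refine ⟨_, rep_core hY2 hr2, ?_⟩
    ext ⟨a, b⟩
    rw [mem_pMap hY2 (hg.step hk hv) hr2]
    simp only [L_step hk hg hv]
    have hJi : ∀ hb : b < k + 1, ((w ⟨b, hb⟩ : Idx k) = w J ↔ b = j) := by
      intro hb
      constructor
      · intro e
        have := hg.inj e
        simpa [J] using this
      · rintro rfl; rfl
    simp only [hJi]
    have hm2 := hmem a b
    simp only [Set.mem_diff, Set.mem_singleton_iff, Prod.mk.injEq, not_and] at hm2
    by_cases hbj : b = j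
    · subst hbj
      constructor
      · rintro ⟨hb3, h3⟩
        have : Lw k w ⟨b, hb3⟩ = i := hLJ
        rw [this] at h3
        simp only [if_true] at h3
        exact hY.2 _ hij _ (by show a ≤ i; omega) le_rfl
      · intro h3
        refine ⟨by omega, ?_⟩
        have : Lw k w ⟨b, by omega⟩ = i := hLJ
        rw [this]
        have := hmax _ _ h3
        simp only [if_true]; omega
    · simp only [hbj, if_false, add_zero]
      rw [← hm2]
      simp [hbj]

lemma pInv_spec {k : ℕ} (hk : 1 ≤ k) {lam : Set Cell} (h : IsBounded k lam) :
    IsCore k (pInv k lam) ∧ pMap k (pInv k lam) = lam := by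
  obtain ⟨S, hS, hp⟩ := pMap_surj hk _ lam h rfl
  have hex : ∃ a ∈ {S | IsCore k S}, pMap k a = lam := ⟨S, hS, hp⟩
  exact ⟨Function.invFunOn_mem hex, Function.invFunOn_eq hex⟩

/-! ### Part 5: transposition, skew shapes -/

lemma transpose_transpose (S : Set Cell) : transposeSet (transposeSet S) = S := rfl

lemma mem_transpose (S : Set Cell) (a b : ℕ) : (a, b) ∈ transposeSet S ↔ (b, a) ∈ S := Iff.rfl

lemma young_transpose {S : Set Cell} (h : IsYoung S) : IsYoung (transposeSet S) := by
  refine ⟨?_, ?_⟩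
  · exact h.1.preimage (f := fun c : Cell => (c.2, c.1)) (fun a _ b _ e => by
      simp only [Prod.mk.injEq] at e; exact Prod.ext e.2 e.1)
  · intro p hp q h1 h2
    exact h.2 _ hp (q.2, q.1) h2 h1

lemma addable_transpose' {S : Set Cell} {c : Cell} (h : Addable S c) :
    Addable (transposeSet S) (c.2, c.1) := by
  refine ⟨h.1, ?_⟩
  have := young_transpose h.2
  have e : transposeSet (S ∪ {c}) = transposeSet S ∪ {(c.2, c.1)} := by
    ext ⟨a, b⟩
    obtain ⟨c1, c2⟩ := c
    simp only [transposeSet, Set.mem_setOf_eq, Set.mem_union, Set.mem_singleton_iff, Prod.mk.injEq]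
    tauto
  rwa [e] at this

lemma addable_transpose {S : Set Cell} (a b : ℕ) :
    Addable (transposeSet S) (a, b) ↔ Addable S (b, a) :=
  ⟨fun h => addable_transpose' h, fun h => addable_transpose' h⟩

lemma res_transpose {k : ℕ} (a b : ℕ) : res k (a, b) = - res k (b, a) := by
  simp [res]

lemma hookLen_transpose (S : Set Cell) (a b : ℕ) :
    hookLen (transposeSet S) (a, b) = hookLen S (b, a) := by
  simp only [hookLen, mem_transpose]
  omega

lemma core_transpose {k : ℕ} {S : Set Cell} (h : IsCore k S) : IsCore k (transposeSet S) := by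
  refine ⟨young_transpose h.1, ?_⟩
  rintro ⟨a, b⟩ hc
  rw [hookLen_transpose]
  exact h.2 _ hc

lemma addSet_transpose {k : ℕ} (x : Idx k) (S : Set Cell) :
    addSet k (-x) (transposeSet S) = transposeSet (addSet k x S) := by
  ext ⟨a, b⟩
  simp only [addSet, Set.mem_union, mem_transpose, Set.mem_setOf_eq, addable_transpose,
    res_transpose a b, neg_inj]

lemma dotCW_transpose {k : ℕ} {S : Set Cell} (u : Word k) (S' : Set Cell)
    (h : dotCW k u (some S) = some S') :
    dotCW k (u.map (fun x => -x)) (some (transposeSet S)) = some (transposeSet S') := by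
  induction u generalizing S' with
  | nil =>
    have : S = S' := Option.some.inj h
    subst this; rfl
  | cons x b ih =>
    obtain ⟨T, hT, hex, rfl⟩ := dotCW_cons h
    have := ih T hT
    show dotC k (-x) (dotCW k (b.map (fun x => -x)) (some (transposeSet S))) = _
    rw [this]
    have hex' : ∃ c, Addable (transposeSet T) c ∧ res k c = -x := by
      obtain ⟨⟨a, b⟩, h1, h2⟩ := hex
      exact ⟨(b, a), (addable_transpose b a).2 h1, by rw [res_transpose, h2]⟩
    simp only [dotC]
    rw [if_pos hex', ← addSet_transpose]
    rfl

lemma skew_lemma {n : ℕ} (l c : Fin n → ℕ) (lam mu : Set Cell)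
    (hlam : ∀ i j, (i, j) ∈ lam ↔ ∃ hj : j < n, i < l ⟨j, hj⟩)
    (hmu : ∀ i j, (i, j) ∈ mu ↔ ∃ hj : j < n, i < l ⟨j, hj⟩ + c ⟨j, hj⟩)
    (hb : ∀ a b, a < b → l b + c b ≤ l a + 1) :
    lam ⊆ mu ∧ (mu \ lam).ncard = ∑ j, c j ∧
      htSkew (mu \ lam) + (Finset.univ.filter (fun j => 0 < c j)).card = ∑ j, c j := by
  have hD : ∀ i j, (i, j) ∈ mu \ lam ↔ ∃ hj : j < n, l ⟨j, hj⟩ ≤ i ∧ i < l ⟨j, hj⟩ + c ⟨j, hj⟩ := by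
    intro i j
    rw [Set.mem_diff, hlam, hmu]
    constructor
    · rintro ⟨⟨h1, h2⟩, h3⟩
      exact ⟨h1, not_lt.1 (fun h4 => h3 ⟨h1, h4⟩), h2⟩
    · rintro ⟨h1, h2, h3⟩
      exact ⟨⟨h1, h3⟩, fun ⟨_, h4⟩ => by omega⟩
  let E : Finset (Σ _ : Fin n, ℕ) := Finset.univ.sigma (fun j => Finset.Ico (l j) (l j + c j))
  let f : (Σ _ : Fin n, ℕ) → Cell := fun x => (x.2, x.1)
  have hf : Function.Injective f := by
    rintro ⟨a, b⟩ ⟨a', b'⟩ e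
    simp only [f, Prod.mk.injEq] at e
    obtain ⟨rfl, e2⟩ := e
    have := Fin.ext e2
    subst this; rfl
  have hDE : mu \ lam = (E.image f : Finset Cell) := by
    ext ⟨i, j⟩
    rw [hD]
    simp only [Finset.coe_image, Set.mem_image, Finset.mem_coe]
    constructor
    · rintro ⟨h1, h2, h3⟩
      exact ⟨⟨⟨j, h1⟩, i⟩, by simp only [E, Finset.mem_sigma, Finset.mem_univ, Finset.mem_Ico, true_and]; exact ⟨h2, h3⟩, rfl⟩
    · rintro ⟨⟨a, b⟩, h1, h2⟩
      simp only [f, Prod.mk.injEq] at h2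
      obtain ⟨rfl, rfl⟩ := h2
      simp only [E, Finset.mem_sigma, Finset.mem_univ, Finset.mem_Ico, true_and] at h1
      exact ⟨a.2, h1⟩
  have hfin : (mu \ lam).Finite := by rw [hDE]; exact Finset.finite_toSet _
  refine ⟨?_, ?_, ?_⟩
  · rintro ⟨i, j⟩ h
    rw [hlam] at h; rw [hmu]
    obtain ⟨h1, h2⟩ := h
    exact ⟨h1, by omega⟩
  · rw [hDE, Set.ncard_coe_finset, Finset.card_image_of_injective _ hf, Finset.card_sigma]
    simp
  · set D := mu \ lam
    have hRfin : {i : ℕ | ∃ j, (i, j) ∈ D}.Finite := by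
      apply (hfin.image Prod.fst).subset
      rintro i ⟨j, hj⟩
      exact ⟨_, hj, rfl⟩
    have h1 : htSkew D = {i : ℕ | ∃ j, (i, j) ∈ D ∧ (i + 1, j) ∈ D}.ncard := by
      unfold htSkew
      rw [← Set.ncard_diff (by rintro i ⟨h1, -⟩; exact h1) (hRfin.subset (by rintro i ⟨h1, -⟩; exact h1))]
      congr 1
      ext i
      simp only [Set.mem_diff, Set.mem_setOf_eq, not_and, not_not]
      constructor
      · rintro ⟨h1, h2⟩; exact h2 h1
      · rintro ⟨j, h1, h2⟩; exact ⟨⟨j, h1⟩, fun _ => ⟨j, h1, h2⟩⟩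
    have h2 : {i : ℕ | ∃ j, (i, j) ∈ D ∧ (i + 1, j) ∈ D} =
        ((Finset.univ.biUnion (fun j => Finset.Ico (l j) (l j + c j - 1)) : Finset ℕ) : Set ℕ) := by
      ext i
      simp only [Set.mem_setOf_eq, hD, Finset.coe_biUnion, Set.mem_iUnion, Finset.coe_Ico,
        Set.mem_Ico, Finset.mem_coe, Finset.mem_univ, exists_prop, true_and]
      constructor
      · rintro ⟨j, ⟨h1, h2, h3⟩, ⟨_, h5, h6⟩⟩
        exact ⟨⟨j, h1⟩, h2, by omega⟩
      · rintro ⟨j, h1, h2⟩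
        exact ⟨j, ⟨j.2, h1, by show i < l j + c j; omega⟩,
          ⟨j.2, by show l j ≤ i + 1; omega, by show i + 1 < l j + c j; omega⟩⟩
    rw [h1, h2, Set.ncard_coe_finset, Finset.card_biUnion]
    · simp only [Nat.card_Ico]
      rw [Finset.card_filter, ← Finset.sum_add_distrib]
      apply Finset.sum_congr rfl
      intro j _
      split_ifs <;> omega
    · intro a _ b _ hab
      refine Finset.disjoint_left.2 ?_
      intro i hi1 hi2
      rw [Finset.mem_Ico] at hi1 hi2
      rcases lt_or_gt_of_ne hab with h3 | h3
      · have := hb a b h3; omega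
      · have := hb b a h3; omega

/-! ### Part 6: cells of the core skew shape -/

lemma dotCW_mono {k : ℕ} {S : Set Cell} (u : Word k) (S' : Set Cell)
    (h : dotCW k u (some S) = some S') : S ⊆ S' := by
  induction u generalizing S' with
  | nil =>
    have : S = S' := Option.some.inj h
    subst this; exact subset_rfl
  | cons x b ih =>
    obtain ⟨T, hT, hex, rfl⟩ := dotCW_cons h
    exact (ih T hT).trans Set.subset_union_left

lemma stage {k : ℕ} {S : Set Cell} (u : Word k) (S' : Set Cell)
    (h : dotCW k u (some S) = some S') (q : Cell) (hq : q ∈ S') (hq' : q ∉ S) :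
    ∃ a b T, u = a ++ res k q :: b ∧ dotCW k b (some S) = some T ∧ Addable T q := by
  induction u generalizing S' with
  | nil =>
    have : S = S' := Option.some.inj h
    subst this; exact absurd hq hq'
  | cons x b ih =>
    obtain ⟨T, hT, hex, rfl⟩ := dotCW_cons h
    rcases hq with h1 | ⟨h1, h2⟩
    · obtain ⟨a, b', T', e, h3, h4⟩ := ih T hT h1
      exact ⟨x :: a, b', T', by rw [e]; rfl, h3, h4⟩
    · exact ⟨[], b, T, by rw [h2]; rfl, hT, h1⟩

lemma block_sublist {k : ℕ} {S : Set Cell} (u : Word k) (S' : Set Cell)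
    (h : dotCW k u (some S) = some S') (hn : ¬ IsRibbon (S' \ S)) :
    ∃ c : Idx k, [c, c + 1, c].Sublist u := by
  unfold IsRibbon at hn
  push Not at hn
  obtain ⟨⟨i, j⟩, h1, h2, h3, h4⟩ := hn
  simp only at h1 h2 h3 h4
  obtain ⟨a, b, T, e, hT, hA⟩ := stage u S' h _ h4.1 h4.2
  have m1 : (i, j + 1) ∈ T := by
    rcases hA.2.2 _ (Or.inr rfl) (i, j + 1) (Nat.le_succ _) le_rfl with h5 | h5
    · exact h5
    · simp at h5
  obtain ⟨a2, b2, T2, e2, hT2, hA2⟩ := stage b T hT _ m1 h3.2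
  have m2 : (i, j) ∈ T2 := by
    rcases hA2.2.2 _ (Or.inr rfl) (i, j) le_rfl (Nat.le_succ _) with h5 | h5
    · exact h5
    · simp at h5
  obtain ⟨a3, b3, T3, e3, hT3, hA3⟩ := stage b2 T2 hT2 _ m2 h1.2
  refine ⟨res k (i, j), ?_⟩
  have r1 : res k (i + 1, j + 1) = res k (i, j) := by simp [res]
  have r2 : res k (i, j + 1) = res k (i, j) + 1 := by simp [res]; ring
  rw [e, e2, e3, r1, r2]
  refine List.Sublist.trans ?_ (List.sublist_append_right _ _)
  refine List.Sublist.cons_cons _ ?_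
  refine List.Sublist.trans ?_ (List.sublist_append_right _ _)
  refine List.Sublist.cons_cons _ ?_
  refine List.Sublist.trans ?_ (List.sublist_append_right _ _)
  refine List.Sublist.cons_cons _ (List.nil_sublist _)

lemma resid_eq {k : ℕ} {S : Set Cell} (u : Word k) (S' : Set Cell)
    (h : dotCW k u (some S) = some S') : residSupp k (S' \ S) = supp k u := by
  ext x
  simp only [residSupp, Set.Finite.mem_toFinset, supp, List.mem_toFinset]
  constructor
  · rintro ⟨q, ⟨h1, h2⟩, rfl⟩
    obtain ⟨a, b, T, e, -⟩ := stage u S' h q h1 h2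
    rw [e]; simp
  · intro hx
    induction u generalizing S' with
    | nil => simp at hx
    | cons y b ih =>
      obtain ⟨T, hT, ⟨c, hc1, hc2⟩, rfl⟩ := dotCW_cons h
      rcases List.mem_cons.1 hx with h1 | h1
      · subst h1
        exact ⟨c, ⟨Or.inr ⟨hc1, hc2⟩, fun hh => hc1.1 (dotCW_mono b T hT hh)⟩, hc2⟩
      · obtain ⟨q, ⟨h2, h3⟩, h4⟩ := ih T hT h1
        exact ⟨q, ⟨Or.inl h2, h3⟩, h4⟩

/-! ### Part 7: words -/

lemma gap_not_mem {k : ℕ} {S : Finset (Idx k)} (h : S ≠ Finset.univ) : gap k S ∉ S := by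
  have hex : ∃ m : ℕ, m ≤ k ∧ (m : Idx k) ∉ S := by
    by_contra hcon
    push Not at hcon
    apply h
    rw [Finset.eq_univ_iff_forall]
    intro x
    have := hcon x.val (Nat.lt_succ_iff.1 (ZMod.val_lt x))
    rwa [ZMod.natCast_zmod_val] at this
  unfold gap gapNat
  rw [dif_pos hex]
  exact (Nat.find_spec hex).2

lemma pos_inj {k : ℕ} {S : Finset (Idx k)} {a b : Idx k} (h : pos k S a = pos k S b) : a = b := by
  have := ZMod.val_injective _ h
  linear_combination this

lemma pos_succ {k : ℕ} {S : Finset (Idx k)} {b : Idx k} (h : b ≠ gap k S) :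
    pos k S (b + 1) = pos k S b + 1 := by
  unfold pos
  set y := b - gap k S - 1 with hy
  have e : b + 1 - gap k S - 1 = y + 1 := by rw [hy]; ring
  rw [e]
  have hv : y.val < k := by
    have h1 := ZMod.val_lt y
    have h2 : y.val ≠ k := by
      intro h3
      have h4 : ((y.val : ℕ) : Idx k) = y := ZMod.natCast_zmod_val y
      rw [h3] at h4
      apply h
      have h5 : ((k : ℕ) : Idx k) + 1 = 0 := by
        have := ZMod.natCast_self (k + 1)
        push_cast at this; exact this
      linear_combination hy - h4 + h5
    omega
  haveI : Fact (1 < k + 1) := ⟨by omega⟩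
  have h1 : (1 : Idx k).val = 1 := ZMod.val_one (k + 1)
  rw [ZMod.val_add_of_lt (by rw [h1]; omega), h1]

lemma pos_gap_succ {k : ℕ} {S : Finset (Idx k)} : pos k S (gap k S + 1) = 0 := by
  simp [pos]

lemma asc_list (v : ℕ) (as : List ℕ) (h : (v :: as).Pairwise (· < ·)) :
    ((v :: as).zip (v :: as).tail).countP (fun p => decide (p.1 < p.2)) = as.length := by
  induction as generalizing v with
  | nil => simp
  | cons a as ih =>
    have h1 : v < a := (List.pairwise_cons.1 h).1 a (by simp)
    have := ih a (List.pairwise_cons.1 h).2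
    simp only [List.tail_cons, List.zip_cons_cons, List.countP_cons] at this ⊢
    rw [this]; simp [h1]

lemma asc_list2 (ds : List ℕ) (v : ℕ) (as : List ℕ) (h0 : (ds ++ [v]).Pairwise (· > ·))
    (h : (v :: as).Pairwise (· < ·)) :
    ((ds ++ v :: as).zip (ds ++ v :: as).tail).countP (fun p => decide (p.1 < p.2)) = as.length := by
  induction ds with
  | nil => exact asc_list v as h
  | cons d ds ih =>
    have h1 := (List.pairwise_cons.1 h0)
    have := ih h1.2
    cases ds with
    | nil =>
      have h2 : v < d := h1.1 v (by simp)
      simp only [List.cons_append, List.nil_append, List.tail_cons, List.zip_cons_cons,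
        List.countP_cons] at this ⊢
      rw [this]; simp; omega
    | cons d' ds =>
      have h2 : d' < d := h1.1 d' (by simp)
      simp only [List.cons_append, List.tail_cons, List.zip_cons_cons,
        List.countP_cons] at this ⊢
      rw [this]; simp; omega

lemma word_split {k : ℕ} {u : Word k} (hu : IsHookV k u) : ∃ (ds as : Word k) (v : Idx k),
    u = ds ++ v :: as ∧
    (ds ++ [v]).Pairwise (fun a b => pos k (supp k u) b < pos k (supp k u) a) ∧
    (v :: as).Pairwise (fun a b => pos k (supp k u) a < pos k (supp k u) b) ∧
    asc k u = as.length := by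
  obtain ⟨-, ds', as', v', h1, h2, h3⟩ := hu
  have h2 : (ds' ++ [v']).Pairwise (· > ·) := List.isChain_iff_pairwise.1 h2
  have h3 : (v' :: as').Pairwise (· < ·) := List.isChain_iff_pairwise.1 h3
  have h4 : asc k u = as'.length := by
    unfold asc; rw [h1]; exact asc_list2 ds' v' as' h2 h3
  unfold posList at h1
  obtain ⟨ds, t, e1, rfl, e2⟩ := List.map_eq_append_iff.1 h1
  obtain ⟨v, as, rfl, rfl, rfl⟩ := List.map_eq_cons_iff.1 e2
  refine ⟨ds, as, v, e1, ?_, ?_, by simpa using h4⟩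
  · have e : ds.map (pos k (supp k u)) ++ [pos k (supp k u) v] = (ds ++ [v]).map (pos k (supp k u)) := by simp
    rw [e, List.pairwise_map] at h2
    exact h2
  · have e : pos k (supp k u) v :: as.map (pos k (supp k u)) = (v :: as).map (pos k (supp k u)) := by simp
    rw [e, List.pairwise_map] at h3
    exact h3

/-- all the combinatorial facts about the word that are needed -/
lemma word_facts {k : ℕ} {u : Word k} (hu : IsHookV k u) (hc : IsKConnected k u) :
    ∃ (ds as : Word k) (v : Idx k), u = ds ++ v :: as ∧ asc k u = as.length ∧
    (∀ c, ¬ [c, c + 1, c].Sublist u) ∧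
    (Asc k ds ∧ Dsc k (v :: as) ∧ (∀ p, p ∉ v :: as → p + 1 ∈ v :: as → p = v - 1 ∨ p ∈ ds) ∧
      v - 1 ∉ ds) ∧
    (Dsc k (ds.map (fun x => -x) ++ [-v]) ∧ Asc k (as.map (fun x => -x)) ∧
      (∀ p ∈ ds.map (fun x => -x) ++ [-v], p + 1 ∉ ds.map (fun x => -x) ++ [-v] →
        p = -v ∨ p + 1 ∈ as.map (fun x => -x)) ∧
      -v ∉ as.map (fun x => -x) ∧ -v + 1 ∉ as.map (fun x => -x)) := by
  obtain ⟨ds, as, v, e, hd, ha, hasc⟩ := word_split hu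
  have hgap := gap_not_mem hu.1
  have hmem : ∀ x, x ∈ supp k u ↔ x ∈ ds ∨ x = v ∨ x ∈ as := by
    intro x; simp only [supp, List.mem_toFinset]; rw [e]; simp
  have hsucc : ∀ x, x ∈ supp k u → pos k (supp k u) (x + 1) = pos k (supp k u) x + 1 := by
    intro x hx
    apply pos_succ
    rintro rfl; exact hgap hx
  set P := pos k (supp k u) with hP
  have hdv : ∀ x ∈ ds, P v < P x := by
    intro x hx
    exact (List.pairwise_append.1 hd).2.2 x hx v (by simp)
  have hav : ∀ x ∈ as, P v < P x := (List.pairwise_cons.1 ha).1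
  have hvs : v ∈ supp k u := (hmem v).2 (by simp)
  have hpred : ∀ q ∈ supp k u, P v < P q → q - 1 ∈ supp k u := by
    intro q hq hlt
    have hne : q - 1 ≠ gap k (supp k u) := by
      intro hh
      have : q = gap k (supp k u) + 1 := by rw [← hh]; ring
      have h0 : P q = 0 := by rw [hP, this]; exact pos_gap_succ
      omega
    have h1 := pos_succ hne
    rw [sub_add_cancel] at h1
    have h1 : P q = P (q - 1) + 1 := h1
    exact hc.2 v hvs q hq (q - 1) (by show P v ≤ P (q - 1); omega) (by show P (q - 1) ≤ P q; omega)
  have hdpos : ∀ x ∈ ds ++ [v], x ∈ supp k u := by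
    intro x hx; rw [hmem]; simp at hx; tauto
  have hapos : ∀ x ∈ v :: as, x ∈ supp k u := by
    intro x hx; rw [hmem]; simp at hx; tauto
  refine ⟨ds, as, v, e, hasc, ?_, ⟨?_, ?_, ?_, ?_⟩, ⟨?_, ?_, ?_, ?_, ?_⟩⟩
  · intro c hsub
    have hcs : c ∈ supp k u := by
      simp only [supp, List.mem_toFinset]; exact hsub.subset (by simp)
    have hc1 := hsucc c hcs
    rw [e] at hsub
    obtain ⟨l1, l2, h1, h2, h3⟩ := List.sublist_append_iff.1 hsub
    have p1 := (hd.sublist (List.sublist_append_left ds [v])).sublist h2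
    have p2 := ha.sublist h3
    rcases l1 with _ | ⟨x, _ | ⟨y, l1⟩⟩
    · simp only [List.nil_append] at h1
      subst h1
      simp at p2
    · simp only [List.cons_append, List.nil_append, List.cons.injEq] at h1
      obtain ⟨rfl, rfl⟩ := h1
      simp at p2
      omega
    · simp only [List.cons_append, List.cons.injEq] at h1
      obtain ⟨rfl, rfl, -⟩ := h1
      have := (List.pairwise_cons.1 p1).1 (c + 1) (by simp)
      omega
  · refine List.Pairwise.imp_of_mem ?_ (List.pairwise_append.1 hd).1
    intro a b h1 h2 hab
    have := hsucc a (hdpos a (by simp [h1]))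
    refine ⟨?_, ?_⟩
    · rintro rfl; omega
    · rintro rfl; omega
  · refine List.Pairwise.imp_of_mem ?_ ha
    intro a b h1 h2 hab
    have := hsucc b (hapos b h2)
    refine ⟨?_, ?_⟩
    · rintro rfl; omega
    · rintro rfl; omega
  · intro p h1 h2
    rcases List.mem_cons.1 h2 with h3 | h3
    · left; rw [← h3]; ring
    · right
      have := hpred (p + 1) (hapos _ h2) (hav _ h3)
      rw [add_sub_cancel_right, hmem] at this
      simp only [List.mem_cons, not_or] at h1
      tauto
  · intro h1
    have h2 := hdv _ h1
    have h3 := hsucc _ (hdpos (v - 1) (by simp [h1]))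
    rw [sub_add_cancel] at h3
    omega
  · have e2 : ds.map (fun x => -x) ++ [-v] = (ds ++ [v]).map (fun x => -x) := by simp
    rw [e2]
    unfold Dsc
    rw [List.pairwise_map]
    refine List.Pairwise.imp_of_mem ?_ hd
    intro a b h1 h2 hab
    have h3 := hsucc a (hdpos a h1)
    refine ⟨?_, ?_⟩
    · intro hh; have := neg_inj.1 hh; subst this; omega
    · intro hh
      have : b = a + 1 := by linear_combination hh
      subst this; omega
  · unfold Asc
    rw [List.pairwise_map]
    refine List.Pairwise.imp_of_mem ?_ (List.pairwise_cons.1 ha).2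
    intro a b h1 h2 hab
    have h3 := hsucc b (hapos b (by simp [h2]))
    refine ⟨?_, ?_⟩
    · intro hh; have := neg_inj.1 hh; subst this; omega
    · intro hh
      have : a = b + 1 := by linear_combination hh
      subst this; omega
  · have e2 : ds.map (fun x => -x) ++ [-v] = (ds ++ [v]).map (fun x => -x) := by simp
    rw [e2]
    intro p hp hp1
    obtain ⟨q, hq, rfl⟩ := List.mem_map.1 hp
    have hq1 : q - 1 ∉ ds ++ [v] := by
      intro hh
      apply hp1
      exact List.mem_map.2 ⟨q - 1, hh, by ring⟩
    by_cases hqv : q = v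
    · left; rw [hqv]
    · right
      have hqd : q ∈ ds := by simpa [hqv] using hq
      have := hpred q (hdpos q hq) (hdv q hqd)
      rw [hmem] at this
      have h5 : q - 1 ∈ as := by
        simp only [List.mem_append, List.mem_singleton, not_or] at hq1
        tauto
      exact List.mem_map.2 ⟨q - 1, h5, by ring⟩
  · intro hh
    obtain ⟨a, h1, h2⟩ := List.mem_map.1 hh
    have := neg_inj.1 h2
    subst this
    have := hav _ h1; omega
  · intro hh
    obtain ⟨a, h1, h2⟩ := List.mem_map.1 hh
    have h3 := hav _ h1
    have h4 := hsucc a (hapos a (by simp [h1]))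
    have : v = a + 1 := by linear_combination h2
    rw [this] at h3; omega

theorem statement18 (k : ℕ) (hk : 1 ≤ k) (u : Word k)
    (hu : IsHookV k u) (hc : IsKConnected k u)
    (r : ℕ) (hr : u.length = r) (hr1 : 1 ≤ r) (hrk : r ≤ k)
    (lam : Set Cell) (hlam : IsBounded k lam)
    (mu : Set Cell) (hmu : IsBounded k mu) (huact : dotB k u lam = some mu) :
    lam ⊆ mu ∧ kconj k lam ⊆ kconj k mu ∧
    (mu \ lam).ncard = r ∧
    IsRibbon (pInv k mu \ pInv k lam) ∧
    IsKConnectedSet k (residSupp k (pInv k mu \ pInv k lam)) ∧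
    htSkew (mu \ lam) + htSkew (kconj k mu \ kconj k lam) = r - 1 ∧
    htSkew (mu \ lam) = asc k u := by
  obtain ⟨hS, hpS⟩ := pInv_spec hk hlam
  obtain ⟨hM, hpM⟩ := pInv_spec hk hmu
  unfold dotB at huact
  obtain ⟨S', hS', hpS'⟩ := Option.map_eq_some_iff.1 huact
  unfold kconj
  set S := pInv k lam with hSdef
  obtain ⟨w, hg, hrep⟩ := exists_rep hS
  obtain ⟨hv, hY', hrep'⟩ := dotCW_rep hk hS.1 hg hrep u S' hS'
  have hMS : pInv k mu = S' := pMap_inj hM (rep_core hY' hrep') (by rw [hpM, hpS'])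
  rw [hMS]
  have hTr := core_transpose hS
  obtain ⟨w2, hg2, hrep2⟩ := exists_rep hTr
  have hS2 := dotCW_transpose u S' hS'
  obtain ⟨hv2, -, -⟩ := dotCW_rep hk hTr.1 hg2 hrep2 _ _ hS2
  obtain ⟨ds, as, v, e, hasc, hrib, ⟨a1, a2, a3, a4⟩, ⟨b1, b2, b3, b4, b5⟩⟩ := word_facts hu hc
  have hlen : ds.length + 1 + as.length = r := by rw [← hr, e]; simp; omega
  have e2 : u.map (fun x => -x) = (ds.map (fun x => -x) ++ [-v]) ++ as.map (fun x => -x) := by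
    rw [e]; simp
  have hsum := cnt_sum hk hg hv
  have hsum2 := cnt_sum hk hg2 hv2
  rw [List.length_map] at hsum2
  have t1 := typeI hk hg ds as v a1 a2 (by rw [← e]; exact hv) a3 a4
  have t2 := typeII hk hg2 (ds.map (fun x => -x)) (as.map (fun x => -x)) (-v) b1 b2
    (by rw [← e2]; exact hv2) b3 b4 b5
  rw [← e] at t1
  rw [← e2, List.length_map] at t2
  have k1 := skew_lemma (Lw k w) (cnt k u w) lam mu
    (fun i j => by rw [← hpS]; exact mem_pMap hS.1 hg hrep i j)
    (fun i j => by rw [← hpS']; exact pMap_word hk hS.1 hg hrep u S' hS' i j)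
    (fun a b hab => by rw [← L_word hk hg hv]; exact t1.2 a b hab)
  have k2 := skew_lemma (Lw k w2) (cnt k (u.map (fun x => -x)) w2) (pMap k (transposeSet S))
    (pMap k (transposeSet S'))
    (fun i j => mem_pMap hTr.1 hg2 hrep2 i j)
    (fun i j => pMap_word hk hTr.1 hg2 hrep2 _ _ hS2 i j)
    (fun a b hab => by rw [← L_word hk hg2 hv2]; exact t2.2 a b hab)
  obtain ⟨k11, k12, k13⟩ := k1
  obtain ⟨k21, k22, k23⟩ := k2
  rw [hsum, hr] at k12 k13
  rw [hsum2, hr, t2.1] at k23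
  rw [t1.1] at k13
  refine ⟨k11, k21, k12, ?_, ?_, ?_, ?_⟩
  · by_contra hcon
    obtain ⟨c, hcs⟩ := block_sublist u S' hS' hcon
    exact hrib c hcs
  · rw [resid_eq u S' hS']; exact hc
  · omega
  · rw [hasc]; omega

end MN

end
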